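/- Let κ ∈ ℝ, a > 0, let Q₁, Q₂ ∈ A¹(ℝ₊), let s be an admissible threshold for both (Q₁,κ) and (Q₂,κ), and let A₁, A₂ ∈ L¹_s(ℝ₊) be A_κ-amplitudes of Q₁ and Q₂ respectively. Then A₁(t) = A₂(t) for almost every t ∈ (0,a) if and only if Q₁(t) = Q₂(t) for almost every t ∈ (0,a). -/

import Mathlib

open MeasureTheory

noncomputable section

/-- Bessel function of the first kind `J_ν(w)`, with principal complex powers. -/
def besselJ (ν w : ℂ) : ℂ :=
  ∑' n : ℕ, ((-1 : ℂ) ^ n / ((n.factorial : ℂ) * Complex.Gamma (ν + (n : ℂ) + 1))) *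
    (w / 2) ^ (ν + 2 * (n : ℂ))

/-- Principal square root of a real number, viewed in ℂ (equals `i√(−κ)` for `κ < 0`). -/
def csqrt (κ : ℝ) : ℂ := (κ : ℂ) ^ (1/2 : ℂ)

/-- The solution `u_z(t;κ)`. -/
def uzSol (κ : ℝ) (z : ℝ) (t : ℝ) : ℂ :=
  if κ = 0 then Complex.exp (-((z * t : ℝ) : ℂ))
  else besselJ (z : ℂ) (csqrt κ * Complex.exp (-(t : ℂ))) / besselJ (z : ℂ) (csqrt κ)

/-- The Weyl–Titchmarsh function `m_κ(z)` of the reference potential `Q_κ`. -/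
def mWT (κ : ℝ) (z : ℝ) : ℂ :=
  if κ = 0 then -(z : ℂ)
  else -(z : ℂ) + csqrt κ * besselJ ((z : ℂ) + 1) (csqrt κ) / besselJ (z : ℂ) (csqrt κ)

/-- The smallest positive zero of `J₀`. -/
def j01 : ℝ := sInf {x : ℝ | 0 < x ∧ besselJ 0 (x : ℂ) = 0}

/-- Membership in `A¹(ℝ₊)`: measurable, locally integrable on `[0,∞)`, with uniformly bounded
integrals over unit intervals. -/
def MemA1 (Q : ℝ → ℝ) : Prop :=
  Measurable Q ∧ (∀ x : ℝ, 0 ≤ x → IntegrableOn Q (Set.Icc x (x + 1))) ∧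
    BddAbove (Set.range fun x : Set.Ici (0 : ℝ) => ∫ t in Set.Icc x.1 (x.1 + 1), |Q t|)

/-- The norm `⦀Q⦀ = sup_{x ≥ 0} ∫_x^{x+1} |Q|`. -/
def A1norm (Q : ℝ → ℝ) : ℝ :=
  ⨆ x : Set.Ici (0 : ℝ), ∫ t in Set.Icc x.1 (x.1 + 1), |Q t|

/-- `z_Q = 2e(⦀Q⦀ + √⦀Q⦀)`. -/
def zQ (Q : ℝ → ℝ) : ℝ := 2 * Real.exp 1 * (A1norm Q + Real.sqrt (A1norm Q))

/-- `s` is an admissible threshold for `(Q,κ)`. -/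
def AdmissibleThreshold (κ : ℝ) (Q : ℝ → ℝ) (s : ℝ) : Prop :=
  zQ Q ≤ s ∧ 0 ≤ s ∧ (0 < κ → Real.sqrt κ - j01 < s)

/-- Membership in `L¹_s(ℝ₊)` for a real-valued function. -/
def MemL1s (s : ℝ) (A : ℝ → ℝ) : Prop :=
  IntegrableOn (fun t => A t * Real.exp (-2 * s * t)) (Set.Ioi 0)

/-- `(v,w)` is a solution pair for `(Q,z)`: `v ∈ L²(ℝ₊)` solves `−v'' + Qv = −z²v`, `v(0)=1`,
with `w = v'`. -/
def SolutionPair (Q : ℝ → ℝ) (z : ℂ) (v w : ℝ → ℂ) : Prop :=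
  Integrable (fun t => ‖v t‖ ^ 2) (volume.restrict (Set.Ioi (0 : ℝ))) ∧
  (∀ t : ℝ, 0 ≤ t → IntervalIntegrable w volume 0 t) ∧
  (∀ t : ℝ, 0 ≤ t → IntervalIntegrable (fun s => ((Q s : ℂ) + z ^ 2) * v s) volume 0 t) ∧
  (∀ t : ℝ, 0 ≤ t → v t = 1 + ∫ s in (0 : ℝ)..t, w s) ∧
  (∀ t : ℝ, 0 ≤ t → w t = w 0 + ∫ s in (0 : ℝ)..t, ((Q s : ℂ) + z ^ 2) * v s)

/-- `A` is an `A_κ`-amplitude of `Q` relative to the threshold `s`. -/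
def IsAmplitude (κ : ℝ) (Q : ℝ → ℝ) (s : ℝ) (A : ℝ → ℝ) : Prop :=
  MemL1s s A ∧ ∀ z : ℝ, s ≤ z → ∀ v w : ℝ → ℂ, SolutionPair Q (z : ℂ) v w →
    w 0 - mWT κ z = ∫ t in Set.Ioi (0 : ℝ), (A t : ℂ) * (uzSol κ z t) ^ 2

end


section Helpers

open Set Filter Topology


/-- `P` is a primitive of the integrable function `p` on `[0,T]`. -/
def IsPrim (P p : ℝ → ℂ) (T : ℝ) : Prop :=
  IntervalIntegrable p volume 0 T ∧ ∀ t ∈ Icc (0:ℝ) T, P t = P 0 + ∫ x in (0:ℝ)..t, p x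

lemma ac_congr {f g : ℝ → ℂ} {a b : ℝ} (hf : AbsolutelyContinuousOnInterval f a b)
    (h : ∀ x ∈ uIcc a b, f x = g x) : AbsolutelyContinuousOnInterval g a b := by
  rw [absolutelyContinuousOnInterval_iff] at hf ⊢
  intro ε hε
  obtain ⟨δ, hδ, H⟩ := hf ε hε
  refine ⟨δ, hδ, fun E hE hd => ?_⟩
  have := H E hE hd
  convert this using 1
  refine Finset.sum_congr rfl fun i hi => ?_
  rw [h _ (hE.left i hi).1, h _ (hE.left i hi).2]

lemma ac_ofReal {f : ℝ → ℝ} {a b : ℝ} (hf : AbsolutelyContinuousOnInterval f a b) :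
    AbsolutelyContinuousOnInterval (fun x => ((f x : ℝ) : ℂ)) a b := by
  have h1 : AbsolutelyContinuousOnInterval (fun _ : ℝ => (1:ℂ)) a b :=
    (contDiffOn_const).absolutelyContinuousOnInterval
  refine ac_congr (hf.smul h1) ?_
  intro x _
  simp

lemma ac_integral {p : ℝ → ℂ} {T : ℝ} (hp : IntervalIntegrable p volume 0 T) :
    AbsolutelyContinuousOnInterval (fun t => ∫ x in (0:ℝ)..t, p x) 0 T := by
  have hre : IntervalIntegrable (fun x => (p x).re) volume 0 T :=
    ⟨hp.1.re, hp.2.re⟩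
  have him : IntervalIntegrable (fun x => (p x).im) volume 0 T :=
    ⟨hp.1.im, hp.2.im⟩
  have h1 := ac_ofReal (hre.absolutelyContinuousOnInterval_intervalIntegral (c := 0) (by simp))
  have h2 := ac_ofReal (him.absolutelyContinuousOnInterval_intervalIntegral (c := 0) (by simp))
  have h3 := h1.add (h2.const_smul Complex.I)
  refine ac_congr h3 ?_
  intro x hx
  have hpx : IntervalIntegrable p volume 0 x := hp.mono_set (by
    exact uIcc_subset_uIcc (by simp) hx)
  have e1 := Complex.reCLM.intervalIntegral_comp_comm hpx
  have e2 := Complex.imCLM.intervalIntegral_comp_comm hpx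
  simp only [Complex.reCLM_apply, Complex.imCLM_apply] at e1 e2
  simp only [Pi.add_apply, e1, e2, smul_eq_mul]
  rw [mul_comm]
  exact Complex.re_add_im _

namespace IsPrim

variable {P p R r : ℝ → ℂ} {T : ℝ}

lemma mono (h : IsPrim P p T) {t : ℝ} (ht : t ∈ Icc 0 T) : IsPrim P p t := by
  refine ⟨h.1.mono_set ?_, fun x hx => h.2 x ⟨hx.1, hx.2.trans ht.2⟩⟩
  rw [uIcc_of_le ht.1, uIcc_of_le (ht.1.trans ht.2)]
  exact Icc_subset_Icc le_rfl ht.2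

lemma ac (h : IsPrim P p T) (hT : 0 ≤ T) : AbsolutelyContinuousOnInterval P 0 T := by
  have h1 : AbsolutelyContinuousOnInterval (fun _ : ℝ => P 0) 0 T :=
    (contDiffOn_const).absolutelyContinuousOnInterval
  refine ac_congr (h1.add (ac_integral h.1)) ?_
  intro x hx
  rw [uIcc_of_le hT] at hx
  exact (h.2 x hx).symm

lemma cont (h : IsPrim P p T) (hT : 0 ≤ T) : ContinuousOn P (Icc 0 T) := by
  have := (h.ac hT).continuousOn
  rwa [uIcc_of_le hT] at this

lemma ae_deriv (h : IsPrim P p T) (hT : 0 ≤ T) :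
    ∀ᵐ x, x ∈ Icc 0 T → HasDerivAt P (p x) x := by
  have h0 : ∀ᵐ x : ℝ, x ≠ 0 := by simp [ae_iff, measure_singleton]
  have h1 : ∀ᵐ x : ℝ, x ≠ T := by simp [ae_iff, measure_singleton]
  filter_upwards [h.1.ae_hasDerivAt_integral, h0, h1] with x hx hx0 hxT hxm
  have hd := hx (by rwa [uIcc_of_le hT]) 0 (by simp)
  have hd' := hd.const_add (P 0)
  refine hd'.congr_of_eventuallyEq ?_
  filter_upwards [Icc_mem_nhds (lt_of_le_of_ne hxm.1 hx0.symm) (lt_of_le_of_ne hxm.2 hxT)] with y hy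
  exact h.2 y hy

lemma of_ac (hT : 0 ≤ T) (hP : AbsolutelyContinuousOnInterval P 0 T)
    (hp : IntervalIntegrable p volume 0 T)
    (hd : ∀ᵐ x, x ∈ Icc 0 T → HasDerivAt P (p x) x) : IsPrim P p T := by
  refine ⟨hp, ?_⟩
  have g_ac := hP.sub (ac_integral hp)
  obtain ⟨C, hC⟩ := g_ac.const_of_ae_hasDerivAt_zero (by
    filter_upwards [hd, hp.ae_hasDerivAt_integral] with x h1 h2 hx
    have := (h1 (by rwa [uIcc_of_le hT] at hx)).sub (h2 hx 0 (by simp))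
    simpa using this)
  intro t ht
  have a1 := hC t (by rwa [uIcc_of_le hT])
  have a2 := hC 0 (by simp)
  simp at a1 a2
  rw [a2, ← a1]; ring

lemma mul (h : IsPrim P p T) (h' : IsPrim R r T) (hT : 0 ≤ T) :
    IsPrim (fun t => P t * R t) (fun t => p t * R t + P t * r t) T := by
  have c1 := h.cont hT
  have c2 := h'.cont hT
  rw [← uIcc_of_le hT] at c1 c2
  refine of_ac hT ((h.ac hT).smul (h'.ac hT)) ?_ ?_
  · exact (h.1.mul_continuousOn c2).add (h'.1.continuousOn_mul c1)
  · filter_upwards [h.ae_deriv hT, h'.ae_deriv hT] with x h1 h2 hx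
    exact (h1 hx).mul (h2 hx)

lemma add (h : IsPrim P p T) (h' : IsPrim R r T) (hT : 0 ≤ T) :
    IsPrim (fun t => P t + R t) (fun t => p t + r t) T := by
  refine of_ac hT ((h.ac hT).add (h'.ac hT)) (h.1.add h'.1) ?_
  · filter_upwards [h.ae_deriv hT, h'.ae_deriv hT] with x h1 h2 hx
    exact (h1 hx).add (h2 hx)

lemma sub (h : IsPrim P p T) (h' : IsPrim R r T) (hT : 0 ≤ T) :
    IsPrim (fun t => P t - R t) (fun t => p t - r t) T := by
  refine of_ac hT ((h.ac hT).sub (h'.ac hT)) (h.1.sub h'.1) ?_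
  · filter_upwards [h.ae_deriv hT, h'.ae_deriv hT] with x h1 h2 hx
    exact (h1 hx).sub (h2 hx)

lemma of_hasDerivAt (hd : ∀ t, HasDerivAt P (p t) t) (hc : Continuous p) : IsPrim P p T := by
  refine ⟨hc.intervalIntegrable _ _, fun t ht => ?_⟩
  rw [intervalIntegral.integral_eq_sub_of_hasDerivAt (fun x _ => hd x)
    (hc.intervalIntegrable _ _)]
  ring

lemma const_mul (c : ℂ) (h : IsPrim P p T) :
    IsPrim (fun t => c * P t) (fun t => c * p t) T := by
  refine ⟨h.1.const_mul c, fun t ht => ?_⟩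
  rw [intervalIntegral.integral_const_mul]
  simp only [h.2 t ht]; ring

lemma congr {q : ℝ → ℂ} (h : IsPrim P p T) (hpq : ∀ t ∈ Icc 0 T, p t = q t) (hT : 0 ≤ T) :
    IsPrim P q T := by
  have hu : ∀ t ∈ Icc 0 T, uIoc 0 t ⊆ Icc 0 T := fun t ht => by
    rw [uIoc_of_le ht.1]
    exact fun x hx => ⟨hx.1.le, hx.2.trans ht.2⟩
  refine ⟨h.1.congr (fun x hx => hpq x (hu T ⟨hT, le_rfl⟩ hx)), fun t ht => ?_⟩
  rw [h.2 t ht]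
  congr 1
  refine intervalIntegral.integral_congr_ae (Eventually.of_forall fun x hx => hpq x (hu t ht hx))

lemma hasDerivAt (h : IsPrim P p T) (hc : ContinuousOn p (Icc 0 T)) {t : ℝ} (ht : t ∈ Ioo 0 T) :
    HasDerivAt P (p t) t := by
  have hT : (0:ℝ) ≤ T := ht.1.le.trans ht.2.le
  have hn : Icc 0 T ∈ 𝓝 t := Icc_mem_nhds ht.1 ht.2
  have h1 : HasDerivAt (fun u => ∫ x in (0:ℝ)..u, p x) (p t) t := by
    refine intervalIntegral.integral_hasDerivAt_right (h.mono ⟨ht.1.le, ht.2.le⟩).1 ?_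
      (hc.continuousAt hn)
    exact hc.stronglyMeasurableAtFilter_nhdsWithin measurableSet_Icc t |>.filter_mono
      (by rw [nhdsWithin_eq_nhds.2 hn])
  refine (h1.const_add (P 0)).congr_of_eventuallyEq ?_
  filter_upwards [hn] with y hy
  exact h.2 y hy

end IsPrim


lemma ae_zero_of_integral_zero {f : ℝ → ℂ} {b : ℝ} (hf : IntervalIntegrable f volume 0 b)
    (h : ∀ τ ∈ Ioo 0 b, ∫ x in (0:ℝ)..τ, f x = 0) : ∀ᵐ t, t ∈ Ioo 0 b → f t = 0 := by
  filter_upwards [hf.ae_hasDerivAt_integral] with t ht htm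
  have hb : (0:ℝ) ≤ b := htm.1.le.trans htm.2.le
  have h1 := ht (by rw [uIcc_of_le hb]; exact ⟨htm.1.le, htm.2.le⟩) 0 (by simp)
  have h2 : HasDerivAt (fun x => ∫ (t : ℝ) in (0:ℝ)..x, f t) 0 t := by
    refine (hasDerivAt_const t (0:ℂ)).congr_of_eventuallyEq ?_
    filter_upwards [Ioo_mem_nhds htm.1 htm.2] with y hy
    exact h y hy
  exact h1.unique h2

lemma MemL1s.integrable_exp {s : ℝ} {f : ℝ → ℝ} (hf : MemL1s s f) {z : ℝ} (hz : s ≤ z) :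
    IntegrableOn (fun t => f t * Real.exp (-2 * z * t)) (Ioi 0) := by
  have h : IntegrableOn (fun t => (f t * Real.exp (-2 * s * t)) * Real.exp (-2 * (z - s) * t))
      (Ioi 0) := by
    refine Integrable.mul_bdd (c := 1) hf (by fun_prop) ?_
    refine (ae_restrict_mem measurableSet_Ioi).mono fun t ht => ?_
    rw [Real.norm_eq_abs, Real.abs_exp, Real.exp_le_one_iff]
    have : 0 ≤ (z - s) * t := mul_nonneg (by linarith) (le_of_lt ht)
    nlinarith
  refine h.congr_fun (fun t _ => ?_) measurableSet_Ioi
  simp only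
  rw [mul_assoc, ← Real.exp_add]; congr 2; ring

lemma MemL1s.intervalIntegrable {s : ℝ} {f : ℝ → ℝ} (hf : MemL1s s f) {b : ℝ} (hb : 0 ≤ b) :
    IntervalIntegrable f volume 0 b := by
  rw [intervalIntegrable_iff_integrableOn_Ioc_of_le hb]
  have h1 : IntegrableOn (fun t => f t * Real.exp (-2 * s * t)) (Icc 0 b) := by
    rw [integrableOn_Icc_iff_integrableOn_Ioc]
    exact hf.mono_set (fun x hx => hx.1)
  have h2 := h1.mul_continuousOn (g' := fun t => Real.exp (2 * s * t)) (by fun_prop) isCompact_Icc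
  refine (h2.mono_set Ioc_subset_Icc_self).congr_fun (fun t _ => ?_) measurableSet_Ioc
  simp only
  rw [mul_assoc, ← Real.exp_add]
  ring_nf; simp

lemma one_sub_exp_neg_le {x : ℝ} : 1 - Real.exp (-x) ≤ x := by
  have := Real.add_one_le_exp (-x); linarith

lemma laplace_zero {f : ℝ → ℝ} {s b C z0 : ℝ} (hf : MemL1s s f)
    (hG : ∀ z, z0 ≤ z → |∫ t in Ioi (0:ℝ), f t * Real.exp (-2 * z * t)| ≤ C * Real.exp (-2 * b * z))
    (τ : ℝ) (hτ : τ ∈ Ioo 0 b) : ∫ x in (0:ℝ)..τ, f x = 0 := by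
  have hτ0 := hτ.1
  have hτb := hτ.2
  set Φ : ℝ → ℝ := fun z => ∫ t in Ioi (0:ℝ), f t * (1 - Real.exp (-Real.exp (2 * z * (τ - t))))
    with hΦ
  -- limit
  have L1 : Tendsto Φ atTop (𝓝 (∫ x in (0:ℝ)..τ, f x)) := by
    have e : ∫ x in (0:ℝ)..τ, f x = ∫ t in Ioi (0:ℝ), (Iio τ).indicator f t := by
      rw [setIntegral_indicator measurableSet_Iio, intervalIntegral.integral_of_le hτ0.le,
        Ioi_inter_Iio, integral_Ioc_eq_integral_Ioo]
    rw [e]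
    have hfm : AEStronglyMeasurable f (volume.restrict (Ioi 0)) := by
      have h1 := hf.aestronglyMeasurable.mul
        (g := fun t => Real.exp (2 * s * t)) (by fun_prop)
      refine h1.congr (Eventually.of_forall fun t => ?_)
      simp only [Pi.mul_apply]
      rw [mul_assoc, ← Real.exp_add]
      ring_nf; simp
    refine tendsto_integral_filter_of_dominated_convergence
      (fun t => ‖f t * Real.exp (-2 * s * t)‖ * Real.exp (2 * |s| * τ)) ?_ ?_ ?_ ?_
    · refine Eventually.of_forall fun z => hfm.mul (by fun_prop)
    · filter_upwards [eventually_ge_atTop |s|] with z hz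
      refine (ae_restrict_mem measurableSet_Ioi).mono fun t ht => ?_
      have ht0 : (0:ℝ) < t := ht
      rw [norm_mul, norm_mul, mul_assoc ‖f t‖]
      refine mul_le_mul_of_nonneg_left ?_ (norm_nonneg _)
      have hx := Real.exp_pos (2 * z * (τ - t))
      have hnn : 0 ≤ 1 - Real.exp (-Real.exp (2 * z * (τ - t))) := by
        have := Real.exp_le_one_iff.2 (neg_nonpos.2 hx.le); linarith
      rw [Real.norm_of_nonneg hnn, Real.norm_eq_abs, Real.abs_exp, ← Real.exp_add]
      have hsa := le_abs_self s
      have hsa' := abs_nonneg s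
      have key : 1 - Real.exp (-Real.exp (2 * z * (τ - t))) ≤ Real.exp (2 * |s| * (τ - t)) := by
        rcases le_total t τ with h | h
        · have h1 : 1 ≤ Real.exp (2 * |s| * (τ - t)) := by
            apply Real.one_le_exp
            have := mul_nonneg hsa' (sub_nonneg.2 h); nlinarith
          have := Real.exp_pos (-Real.exp (2 * z * (τ - t)))
          linarith
        · refine one_sub_exp_neg_le.trans (Real.exp_le_exp.2 ?_)
          have := mul_nonneg (sub_nonneg.2 hz) (sub_nonneg.2 h); nlinarith
      refine key.trans (Real.exp_le_exp.2 ?_)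
      have := mul_nonneg (sub_nonneg.2 hsa) ht0.le
      nlinarith
    · exact (Integrable.norm hf).mul_const _
    · have h1 : ∀ᵐ t : ℝ, t ≠ τ := by simp [ae_iff, measure_singleton]
      refine (ae_restrict_of_ae h1).mono fun t ht => ?_
      rcases lt_or_gt_of_ne ht with h | h
      · rw [indicator_of_mem (show t ∈ Iio τ from h)]
        have : Tendsto (fun z : ℝ => Real.exp (-Real.exp (2 * z * (τ - t)))) atTop (𝓝 0) := by
          refine Real.tendsto_exp_neg_atTop_nhds_zero.comp (Real.tendsto_exp_atTop.comp ?_)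
          refine Tendsto.atTop_mul_const (sub_pos.2 h) ?_
          exact tendsto_id.const_mul_atTop (by norm_num)
        simpa using (this.const_sub 1).const_mul (f t)
      · rw [indicator_of_notMem (by simp; exact h.le)]
        have h2 : Tendsto (fun z : ℝ => Real.exp (2 * z * (τ - t))) atTop (𝓝 0) := by
          refine Real.tendsto_exp_atBot.comp ?_
          refine Tendsto.atTop_mul_const_of_neg (sub_neg.2 h) ?_
          exact tendsto_id.const_mul_atTop (by norm_num)
        have h3 : Tendsto (fun z : ℝ => Real.exp (-Real.exp (2 * z * (τ - t)))) atTop (𝓝 1) := by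
          have := (Real.continuous_exp.tendsto (-0)).comp h2.neg
          simpa [Function.comp_def] using this
        simpa using (h3.const_sub 1).const_mul (f t)
  -- bound
  have L2 : ∀ᶠ z in atTop, ‖Φ z‖ ≤ C * (Real.exp (Real.exp (2 * z * (τ - b))) - 1) := by
    filter_upwards [eventually_ge_atTop |s|, eventually_ge_atTop (max z0 0)] with z hz hz1
    have hz0 : z0 ≤ z := (le_max_left _ _).trans hz1
    have hzp : 0 ≤ z := (le_max_right _ _).trans hz1
    have hk : ∀ j : ℕ, z ≤ ((j:ℝ) + 1) * z := fun j => by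
      have : 0 ≤ (j:ℝ) * z := by positivity
      linarith
    set F : ℕ → ℝ → ℝ := fun j t => ((-1)^j / ((j+1).factorial : ℝ) *
      Real.exp (2 * ((j:ℝ)+1) * z * τ)) * (f t * Real.exp (-2 * (((j:ℝ)+1) * z) * t)) with hF
    have hFi : ∀ j, Integrable (F j) (volume.restrict (Ioi 0)) := fun j =>
      (hf.integrable_exp (((le_abs_self s).trans hz).trans (hk j))).const_mul _
    have hexp : ∀ x : ℝ, HasSum (fun j : ℕ => x ^ (j+1) / ((j+1).factorial : ℝ)) (Real.exp x - 1) := by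
      intro x
      have := NormedSpace.expSeries_div_hasSum_exp (𝔸 := ℝ) x
      rw [← Real.exp_eq_exp_ℝ] at this
      have h2 := (hasSum_nat_add_iff' 1).2 this
      simpa using h2
    have hFs : ∀ t, HasSum (fun j => F j t) (f t * (1 - Real.exp (-Real.exp (2 * z * (τ - t))))) := by
      intro t
      have h1 := (hexp (-Real.exp (2 * z * (τ - t)))).mul_left (-f t)
      have hl : (fun j => F j t) = fun i : ℕ => -f t *
          ((-Real.exp (2 * z * (τ - t))) ^ (i + 1) / ((i + 1).factorial : ℝ)) := by
        ext j
        simp only [hF]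
        rw [neg_pow (Real.exp _), ← Real.exp_nat_mul, pow_succ]
        have : Real.exp (((j+1 : ℕ):ℝ) * (2 * z * (τ - t))) =
          Real.exp (2 * ((j:ℝ)+1) * z * τ) * Real.exp (-2 * (((j:ℝ)+1) * z) * t) := by
          rw [← Real.exp_add]; congr 1; push_cast; ring
        rw [this]; ring
      rw [hl, show f t * (1 - Real.exp (-Real.exp (2 * z * (τ - t)))) =
        -f t * (Real.exp (-Real.exp (2 * z * (τ - t))) - 1) by ring]
      exact h1
    have hsum := hasSum_integral_of_summable_integral_norm hFi (by
      set I0 := ∫ t in Ioi (0:ℝ), ‖f t * Real.exp (-2 * s * t)‖ with hI0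
      refine Summable.of_nonneg_of_le (fun j => integral_nonneg fun t => norm_nonneg _) (fun j => ?_)
        ((hexp (Real.exp (2 * z * τ))).summable.mul_right I0)
      rw [hI0, ← integral_const_mul]
      refine integral_mono_ae (hFi j).norm ((Integrable.norm hf).const_mul _) ?_
      refine (ae_restrict_mem measurableSet_Ioi).mono fun t ht => ?_
      have ht0 : (0:ℝ) < t := ht
      simp only [hF]
      rw [norm_mul]
      have e1 : ‖(-1:ℝ)^j / ((j+1).factorial : ℝ) * Real.exp (2 * ((j:ℝ)+1) * z * τ)‖ =
        Real.exp (2 * z * τ) ^ (j + 1) / ((j+1).factorial : ℝ) := by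
        rw [norm_mul, norm_div, norm_pow, norm_neg, norm_one, one_pow, Real.norm_eq_abs (Real.exp _),
          Real.abs_exp, ← Real.exp_nat_mul, Real.norm_natCast]
        push_cast; ring_nf
      rw [e1]
      refine mul_le_mul_of_nonneg_left ?_ (by positivity)
      rw [norm_mul, norm_mul]
      refine mul_le_mul_of_nonneg_left ?_ (norm_nonneg _)
      rw [Real.norm_eq_abs, Real.norm_eq_abs, Real.abs_exp, Real.abs_exp]
      apply Real.exp_le_exp.2
      have := mul_nonneg (sub_nonneg.2 (((le_abs_self s).trans hz).trans (hk j))) ht0.le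
      nlinarith)
    have hΦz : Φ z = ∫ t in Ioi (0:ℝ), ∑' j, F j t := by
      simp only [hΦ]
      refine integral_congr_ae (Eventually.of_forall fun t => ?_)
      exact (hFs t).tsum_eq.symm
    rw [hΦz, ← hsum.tsum_eq]
    refine tsum_of_norm_bounded ((hexp (Real.exp (2 * z * (τ - b)))).mul_left C) fun j => ?_
    simp only [hF]
    rw [integral_const_mul, norm_mul]
    have e1 : ‖(-1:ℝ)^j / ((j+1).factorial : ℝ) * Real.exp (2 * ((j:ℝ)+1) * z * τ)‖ =
        Real.exp (2 * ((j:ℝ)+1) * z * τ) / ((j+1).factorial : ℝ) := by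
      rw [norm_mul, norm_div, norm_pow, norm_neg, norm_one, one_pow, Real.norm_eq_abs (Real.exp _),
        Real.abs_exp, Real.norm_natCast]
      ring
    rw [e1]
    refine (mul_le_mul_of_nonneg_left (hG _ (hz0.trans (hk j))) (by positivity)).trans (le_of_eq ?_)
    rw [← Real.exp_nat_mul]
    have : Real.exp (((j+1 : ℕ):ℝ) * (2 * z * (τ - b))) =
          Real.exp (2 * ((j:ℝ)+1) * z * τ) * Real.exp (-2 * b * (((j:ℝ)+1) * z)) := by
          rw [← Real.exp_add]; congr 1; push_cast; ring
    rw [this]; ring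
  have L3 : Tendsto (fun z => C * (Real.exp (Real.exp (2 * z * (τ - b))) - 1)) atTop (𝓝 0) := by
    have h2 : Tendsto (fun z : ℝ => Real.exp (2 * z * (τ - b))) atTop (𝓝 0) := by
      refine Real.tendsto_exp_atBot.comp ?_
      refine Tendsto.atTop_mul_const_of_neg (sub_neg.2 hτb) ?_
      exact tendsto_id.const_mul_atTop (by norm_num)
    have := (((Real.continuous_exp.tendsto 0).comp h2).sub_const 1).const_mul C
    simpa using this
  exact tendsto_nhds_unique L1 (squeeze_zero_norm' L2 L3)

lemma laplace_ae_zero {f : ℝ → ℝ} {s a : ℝ} (hf : MemL1s s f)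
    (hG : ∀ b ∈ Ioo 0 a, ∃ C z0 : ℝ, ∀ z, z0 ≤ z →
      |∫ t in Ioi (0:ℝ), f t * Real.exp (-2 * z * t)| ≤ C * Real.exp (-2 * b * z)) (ha : 0 < a) :
    ∀ᵐ t, t ∈ Ioo 0 a → f t = 0 := by
  have h := ae_zero_of_integral_zero (f := fun t => (f t : ℂ)) (b := a) ?_ ?_
  · filter_upwards [h] with t ht htm
    exact_mod_cast ht htm
  · have := hf.intervalIntegrable ha.le
    exact ⟨this.1.ofReal, this.2.ofReal⟩
  · intro τ hτ
    obtain ⟨C, z0, h⟩ := hG ((τ + a) / 2) ⟨by linarith [hτ.1, hτ.2], by linarith [hτ.2]⟩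
    rw [intervalIntegral.integral_ofReal, laplace_zero hf h τ ⟨hτ.1, by linarith [hτ.2]⟩]
    simp


lemma sq_series (b : ℕ → ℝ) (hb0 : b 0 = 1) (hb : ∀ n, |b n| ≤ (1/8:ℝ)^n) :
    ∃ c : ℕ → ℝ, c 0 = 1 ∧ (∀ n, |c n| ≤ (1/4:ℝ)^n) ∧ ∀ y : ℝ, 0 ≤ y → y ≤ 1 →
      (∑' n, b n * y ^ n) ^ 2 = ∑' n, c n * y ^ n := by
  refine ⟨fun n => ∑ ij ∈ Finset.HasAntidiagonal.antidiagonal n, b ij.1 * b ij.2, by simp [hb0], ?_, ?_⟩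
  · intro n
    refine (Finset.abs_sum_le_sum_abs _ _).trans ?_
    have h1 : ∀ ij ∈ Finset.HasAntidiagonal.antidiagonal n, |b ij.1 * b ij.2| ≤ (1/8:ℝ)^n := by
      intro ij hij
      rw [Finset.HasAntidiagonal.mem_antidiagonal] at hij
      rw [abs_mul, ← hij, pow_add]
      exact mul_le_mul (hb _) (hb _) (abs_nonneg _) (by positivity)
    refine (Finset.sum_le_card_nsmul _ _ _ h1).trans ?_
    rw [Finset.Nat.card_antidiagonal, nsmul_eq_mul]
    have h2 : ((n + 1 : ℕ) : ℝ) ≤ 2 ^ n := by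
      exact_mod_cast Nat.succ_le_of_lt (Nat.lt_two_pow_self)
    calc ((n+1:ℕ):ℝ) * (1/8:ℝ)^n ≤ 2^n * (1/8:ℝ)^n := by gcongr
      _ = (1/4:ℝ)^n := by rw [← mul_pow]; norm_num
  · intro y hy0 hy1
    have hs : Summable fun n => ‖b n * y ^ n‖ := by
      refine Summable.of_nonneg_of_le (fun n => norm_nonneg _) (fun n => ?_)
        (summable_geometric_of_lt_one (r := (1/8:ℝ)) (by norm_num) (by norm_num))
      rw [norm_mul, norm_pow, Real.norm_eq_abs, Real.norm_eq_abs, abs_of_nonneg hy0]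
      calc |b n| * y ^ n ≤ (1/8)^n * 1 := mul_le_mul (hb n) (pow_le_one₀ hy0 hy1) (by positivity) (by positivity)
        _ = _ := mul_one _
    rw [sq, tsum_mul_tsum_eq_tsum_sum_antidiagonal_of_summable_norm hs hs]
    refine tsum_congr fun n => ?_
    rw [Finset.sum_mul]
    refine Finset.sum_congr rfl fun ij hij => ?_
    rw [Finset.HasAntidiagonal.mem_antidiagonal] at hij
    rw [← hij, pow_add]; ring

lemma csqrt_sq (κ : ℝ) : csqrt κ ^ 2 = κ := by
  unfold csqrt
  simp

/-- The Bessel series coefficients. -/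
noncomputable def bCoef (κ z : ℝ) (n : ℕ) : ℝ :=
  (-κ/4)^n * (Real.Gamma (z+1) / (n.factorial * Real.Gamma (z + n + 1)))

lemma bCoef_bound {κ z : ℝ} (hz : 1 ≤ z) (hk : 2 * |κ| ≤ z) (n : ℕ) :
    |bCoef κ z n| ≤ (1/8:ℝ)^n := by
  have hG : ∀ n : ℕ, z ^ n * Real.Gamma (z+1) ≤ Real.Gamma (z + n + 1) := by
    intro n
    induction n with
    | zero => simp
    | succ k ih =>
      have : Real.Gamma (z + (k+1:ℕ) + 1) = (z + k + 1) * Real.Gamma (z + k + 1) := by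
        rw [← Real.Gamma_add_one (by positivity)]
        congr 1; push_cast; ring
      rw [this, pow_succ]
      have hp : 0 < Real.Gamma (z + 1) := Real.Gamma_pos_of_pos (by linarith)
      have hk0 : (0:ℝ) ≤ k := by positivity
      calc z ^ k * z * Real.Gamma (z+1) = z * (z ^ k * Real.Gamma (z+1)) := by ring
        _ ≤ (z + k + 1) * Real.Gamma (z + k + 1) := by
          apply mul_le_mul (by linarith) ih (by positivity) (by positivity)
  have hp : 0 < Real.Gamma (z + 1) := Real.Gamma_pos_of_pos (by linarith)
  have hp2 : 0 < Real.Gamma (z + n + 1) := Real.Gamma_pos_of_pos (by positivity)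
  have hf : (1:ℝ) ≤ n.factorial := by exact_mod_cast Nat.succ_le_of_lt n.factorial_pos
  unfold bCoef
  rw [abs_mul, abs_pow, abs_of_nonneg (a := Real.Gamma (z+1) / _) (by positivity)]
  have h1 : Real.Gamma (z+1) / (n.factorial * Real.Gamma (z + n + 1)) ≤ (1/z)^n := by
    rw [div_le_iff₀ (by positivity), one_div, inv_pow, ← div_eq_inv_mul, le_div_iff₀ (by positivity)]
    have := hG n
    nlinarith
  calc |-κ/4|^n * (Real.Gamma (z+1) / (n.factorial * Real.Gamma (z + n + 1)))
      ≤ |-κ/4|^n * (1/z)^n := by gcongr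
    _ = (|κ|/(4*z))^n := by
        rw [← mul_pow, abs_div, abs_neg]; congr 1
        rw [abs_of_pos (by norm_num : (0:ℝ) < 4)]; field_simp
    _ ≤ (1/8)^n := by
        refine pow_le_pow_left₀ (by positivity) ?_ n
        rw [div_le_iff₀ (by positivity)]; linarith

lemma besselJ_formula {κ z : ℝ} (hκ : κ ≠ 0) (hz : 1 ≤ z) (t : ℝ) :
    besselJ (z:ℂ) (csqrt κ * Complex.exp (-(t:ℂ))) =
      ((csqrt κ / 2) ^ (z:ℂ) / (Real.Gamma (z+1) : ℂ)) * Complex.exp (-((z*t : ℝ):ℂ)) *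
        ((∑' n, bCoef κ z n * (Real.exp (-2*t)) ^ n : ℝ) : ℂ) := by
  have hc : csqrt κ ≠ 0 := by
    intro h
    have := csqrt_sq κ
    rw [h] at this
    exact hκ (by simpa using this.symm)
  have hc2 : csqrt κ / 2 ≠ 0 := div_ne_zero hc (by norm_num)
  have hp : Real.Gamma (z + 1) ≠ 0 := (Real.Gamma_pos_of_pos (by linarith)).ne'
  unfold besselJ
  rw [Complex.ofReal_tsum, ← tsum_mul_left]
  refine tsum_congr fun n => ?_
  have e1 : csqrt κ * Complex.exp (-(t:ℂ)) / 2 = ((Real.exp (-t) : ℝ) : ℂ) * (csqrt κ / 2) := by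
    push_cast; ring
  have e2 : (csqrt κ * Complex.exp (-(t:ℂ)) / 2) ^ ((z:ℂ) + 2 * (n:ℂ)) =
      (csqrt κ / 2) ^ (z:ℂ) * ((κ:ℂ)/4)^n * Complex.exp (-((z*t : ℝ):ℂ)) *
        ((Real.exp (-2*t)) : ℂ) ^ n := by
    rw [e1, Complex.cpow_def_of_ne_zero (mul_ne_zero (by exact_mod_cast (Real.exp_pos _).ne') hc2),
      Complex.log_ofReal_mul (Real.exp_pos _) hc2, Real.log_exp]
    have e3 : ((κ:ℂ)/4)^n = Complex.exp (Complex.log (csqrt κ / 2) * (2 * n)) := by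
      rw [show ((κ:ℂ)/4) = (csqrt κ / 2)^2 by rw [div_pow, csqrt_sq]; norm_num]
      conv_lhs => rw [← Complex.exp_log hc2]
      rw [← pow_mul, ← Complex.exp_nat_mul]
      congr 1; push_cast; ring
    rw [e3, Complex.cpow_def_of_ne_zero hc2, Complex.ofReal_exp, ← Complex.exp_nat_mul,
      ← Complex.exp_add, ← Complex.exp_add, ← Complex.exp_add]
    congr 1; push_cast; ring
  rw [e2]
  have e4 : Complex.Gamma ((z:ℂ) + n + 1) = ((Real.Gamma (z + n + 1) : ℝ) : ℂ) := by
    rw [← Complex.Gamma_ofReal]; push_cast; rfl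
  rw [e4]
  have hp2 : Real.Gamma (z + n + 1) ≠ 0 := (Real.Gamma_pos_of_pos (by positivity)).ne'
  have hp' : ((Real.Gamma (z+1) : ℝ) : ℂ) ≠ 0 := by exact_mod_cast hp
  have hp2' : ((Real.Gamma (z+n+1) : ℝ) : ℂ) ≠ 0 := by exact_mod_cast hp2
  have hf : (n.factorial : ℂ) ≠ 0 := by exact_mod_cast n.factorial_ne_zero
  unfold bCoef
  push_cast
  have e5 : (-(κ:ℂ)/4)^n = (-1)^n * ((κ:ℂ)/4)^n := by rw [← mul_pow]; congr 1; ring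
  rw [e5]
  field_simp

lemma uz_expand (κ : ℝ) {z : ℝ} (hz : 1 ≤ z) (hk : 2 * |κ| ≤ z) :
    ∃ (D : ℝ) (c : ℕ → ℝ), 1/4 ≤ D ∧ D ≤ 4 ∧ c 0 = 1 ∧ (∀ n, |c n| ≤ (1/4:ℝ)^n) ∧
      ∀ t, 0 ≤ t → (uzSol κ z t) ^ 2 =
        ((D * Real.exp (-2*z*t) * ∑' n, c n * (Real.exp (-2*t)) ^ n : ℝ) : ℂ) := by
  by_cases hκ : κ = 0
  · refine ⟨1, fun n => if n = 0 then 1 else 0, by norm_num, by norm_num, by simp, ?_, ?_⟩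
    · intro n
      by_cases hn : n = 0
      · simp [hn]
      · simp [hn]
    · intro t _
      rw [tsum_eq_single 0 (by intro n hn; simp [hn])]
      simp only [uzSol, hκ, if_true]
      rw [← Complex.exp_nat_mul]
      push_cast
      simp
      ring_nf
  · have hb := bCoef_bound hz hk
    have hb0 : bCoef κ z 0 = 1 := by
      have hp : Real.Gamma (z + 1) ≠ 0 := (Real.Gamma_pos_of_pos (by linarith)).ne'
      simp [bCoef, hp]
    obtain ⟨c, hc0, hc, hsq⟩ := sq_series _ hb0 hb
    set F0 := ∑' n, bCoef κ z n with hF0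
    have hsum : Summable (bCoef κ z) :=
      Summable.of_norm_bounded (summable_geometric_of_lt_one (r := (1/8:ℝ)) (by norm_num) (by norm_num)) hb
    have hF1 : |F0 - 1| ≤ 1/7 := by
      rw [hF0, hsum.tsum_eq_zero_add, hb0, add_sub_cancel_left]
      have hg : HasSum (fun n => (1/8:ℝ) * (1/8:ℝ)^n) (1/8 * (1 - 1/8)⁻¹) :=
        (hasSum_geometric_of_lt_one (by norm_num) (by norm_num)).mul_left _
      have := tsum_of_norm_bounded hg (f := fun n => bCoef κ z (n+1)) (fun n => by
        have := hb (n+1)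
        rw [pow_succ'] at this; exact this)
      rw [← Real.norm_eq_abs]
      refine this.trans ?_
      norm_num
    have hF2 := abs_le.1 hF1
    have hFpos : 0 < F0 := by linarith
    refine ⟨1/F0^2, c, ?_, ?_, hc0, hc, ?_⟩
    · rw [div_le_div_iff₀ (by norm_num) (by positivity)]; nlinarith
    · rw [div_le_iff₀ (by positivity)]; nlinarith
    · intro t ht
      have h1 := besselJ_formula hκ hz t
      have h0 := besselJ_formula hκ hz 0
      simp at h0
      have hK : (csqrt κ / 2) ^ (z:ℂ) / (Real.Gamma (z+1) : ℂ) ≠ 0 := by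
        refine div_ne_zero ?_ (by exact_mod_cast (Real.Gamma_pos_of_pos (by linarith : 0 < z+1)).ne')
        rw [Complex.cpow_ne_zero_iff]
        left
        intro h
        have h3 := csqrt_sq κ
        rw [div_eq_zero_iff] at h
        rcases h with h | h
        · rw [h] at h3
          exact hκ (by simpa using h3.symm)
        · norm_num at h
      rw [← hsq _ (Real.exp_pos _).le (by rw [Real.exp_le_one_iff]; linarith)]
      simp only [uzSol, hκ, if_false]
      rw [h1, h0]
      rw [← hF0]
      have hFne : (F0:ℂ) ≠ 0 := by exact_mod_cast hFpos.ne'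
      set S := ∑' n, bCoef κ z n * (Real.exp (-2*t)) ^ n with hS
      have e : ((Real.exp (-2*z*t) : ℝ):ℂ) = Complex.exp (-((z*t:ℝ):ℂ)) ^ 2 := by
        rw [← Complex.exp_nat_mul]; push_cast; congr 1; ring
      set K := (csqrt κ / 2) ^ (z:ℂ) / (Real.Gamma (z+1) : ℂ) with hKdef
      rw [Complex.ofReal_mul _ (S^2), Complex.ofReal_mul _ (Real.exp _), e]
      push_cast
      field_simp


lemma tsum_c_bound {c : ℕ → ℝ} (hc : ∀ n, |c n| ≤ (1/4:ℝ)^n) {y : ℝ} (hy0 : 0 ≤ y) (hy1 : y ≤ 1) :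
    |∑' n, c n * y ^ n| ≤ 4/3 := by
  have hg : HasSum (fun n => (1/4:ℝ)^n) (1 - 1/4)⁻¹ :=
    hasSum_geometric_of_lt_one (by norm_num) (by norm_num)
  have := tsum_of_norm_bounded hg (f := fun n => c n * y ^ n) (fun n => by
    rw [norm_mul, norm_pow, Real.norm_eq_abs, Real.norm_eq_abs, abs_of_nonneg hy0]
    calc |c n| * y ^ n ≤ (1/4)^n * 1 := mul_le_mul (hc n) (pow_le_one₀ hy0 hy1) (by positivity) (by positivity)
        _ = _ := mul_one _)
  rw [← Real.norm_eq_abs]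
  refine this.trans (by norm_num)

lemma uz_bound (κ : ℝ) {z : ℝ} (hz : 1 ≤ z) (hk : 2 * |κ| ≤ z) {t : ℝ} (ht : 0 ≤ t) :
    ‖(uzSol κ z t) ^ 2‖ ≤ 6 * Real.exp (-2*z*t) := by
  obtain ⟨D, c, hD1, hD2, hc0, hc, hu⟩ := uz_expand κ hz hk
  rw [hu t ht, Complex.norm_real, norm_mul, norm_mul, Real.norm_eq_abs, Real.norm_eq_abs,
    Real.norm_eq_abs, Real.abs_exp, abs_of_nonneg (by linarith : 0 ≤ D)]
  have h := tsum_c_bound hc (Real.exp_pos (-2*t)).le (by rw [Real.exp_le_one_iff]; linarith)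
  have he := Real.exp_pos (-2*z*t)
  calc D * Real.exp (-2*z*t) * |∑' n, c n * (Real.exp (-2*t)) ^ n|
      ≤ 4 * Real.exp (-2*z*t) * (4/3) := by gcongr
    _ ≤ _ := by linarith

lemma laplace_step {κ s : ℝ} {f : ℝ → ℝ} (hf : MemL1s s f) {z : ℝ} (hz : 1 ≤ z)
    (hk : 2 * |κ| ≤ z) (hs : s ≤ z) {B : ℝ}
    (hB : ∀ y, z ≤ y → |∫ t in Ioi (0:ℝ), f t * Real.exp (-2 * y * t)| ≤ B) :
    |∫ t in Ioi (0:ℝ), f t * Real.exp (-2 * z * t)| ≤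
      4 * ‖∫ t in Ioi (0:ℝ), (f t : ℂ) * (uzSol κ z t)^2‖ + B / 3 := by
  obtain ⟨D, c, hD1, hD2, hc0, hc, hu⟩ := uz_expand κ hz hk
  have hDp : 0 < D := by linarith
  set F : ℕ → ℝ → ℝ := fun n t => c n * (f t * Real.exp (-2 * (z + n) * t)) with hF
  have hle : ∀ n : ℕ, z ≤ z + n := fun n => by
    have : (0:ℝ) ≤ n := by positivity
    linarith
  have hFi : ∀ n, Integrable (F n) (volume.restrict (Ioi 0)) := fun n =>
      (hf.integrable_exp (hs.trans (hle n))).const_mul _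
  have hsum := hasSum_integral_of_summable_integral_norm hFi (by
      set I0 := ∫ t in Ioi (0:ℝ), ‖f t * Real.exp (-2 * s * t)‖ with hI0
      refine Summable.of_nonneg_of_le (fun j => integral_nonneg fun t => norm_nonneg _) (fun j => ?_)
        ((summable_geometric_of_lt_one (r := (1/4:ℝ)) (by norm_num) (by norm_num)).mul_right I0)
      rw [hI0, ← integral_const_mul]
      refine integral_mono_ae (hFi j).norm ((Integrable.norm hf).const_mul _) ?_
      refine (ae_restrict_mem measurableSet_Ioi).mono fun t ht => ?_
      have ht0 : (0:ℝ) < t := ht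
      simp only [hF]
      rw [norm_mul]
      refine mul_le_mul (hc j) ?_ (norm_nonneg _) (by positivity)
      rw [norm_mul, norm_mul]
      refine mul_le_mul_of_nonneg_left ?_ (norm_nonneg _)
      rw [Real.norm_eq_abs, Real.norm_eq_abs, Real.abs_exp, Real.abs_exp]
      apply Real.exp_le_exp.2
      have := mul_nonneg (sub_nonneg.2 (hs.trans (hle j))) ht0.le
      nlinarith)
  have hI : ∫ t in Ioi (0:ℝ), (f t : ℂ) * (uzSol κ z t)^2 =
      ((D * ∫ t in Ioi (0:ℝ), ∑' n, F n t : ℝ) : ℂ) := by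
    rw [← integral_const_mul, ← integral_complex_ofReal]
    refine setIntegral_congr_fun measurableSet_Ioi fun t ht => ?_
    rw [hu t (le_of_lt ht), ← Complex.ofReal_mul]
    congr 1
    rw [← tsum_mul_left, ← tsum_mul_left, ← tsum_mul_left]
    refine tsum_congr fun n => ?_
    simp only [hF]
    have : Real.exp (-2 * (z + n) * t) = Real.exp (-2*z*t) * Real.exp (-2*t) ^ n := by
      rw [← Real.exp_nat_mul, ← Real.exp_add]; congr 1; ring
    rw [this]; ring
  rw [hI, Complex.norm_real, norm_mul, Real.norm_of_nonneg hDp.le]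
  have h1 : ∫ t in Ioi (0:ℝ), ∑' n, F n t = (∫ t in Ioi (0:ℝ), f t * Real.exp (-2 * z * t)) +
      ∑' n, ∫ t in Ioi (0:ℝ), F (n+1) t := by
    rw [← hsum.tsum_eq, hsum.summable.tsum_eq_zero_add]
    congr 1
    simp [hF, hc0]
  have h2 : ‖∑' n, ∫ t in Ioi (0:ℝ), F (n+1) t‖ ≤ B / 3 := by
    have hg : HasSum (fun n => ((1/4:ℝ) * (1/4:ℝ)^n) * B) ((1/4 * (1 - 1/4)⁻¹) * B) :=
      ((hasSum_geometric_of_lt_one (by norm_num) (by norm_num)).mul_left _).mul_right B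
    have := tsum_of_norm_bounded hg (f := fun n => ∫ t in Ioi (0:ℝ), F (n+1) t) (fun n => by
      simp only [hF]
      rw [integral_const_mul, norm_mul, ← pow_succ']
      exact mul_le_mul (hc _) (hB _ (hle _)) (norm_nonneg _) (by positivity))
    refine this.trans (le_of_eq ?_)
    norm_num
    ring
  set J := ∫ t in Ioi (0:ℝ), ∑' n, F n t
  set S := ∑' n, ∫ t in Ioi (0:ℝ), F (n+1) t
  have h3 : ∫ t in Ioi (0:ℝ), f t * Real.exp (-2 * z * t) = J - S := by linarith
  rw [h3, Real.norm_eq_abs]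
  rw [Real.norm_eq_abs] at h2
  have h4 := abs_sub J S
  have h5 : |J| ≤ 4 * (D * |J|) := by nlinarith [abs_nonneg J]
  linarith

lemma laplace_of_amp {κ s b C z0 : ℝ} {f : ℝ → ℝ} (hf : MemL1s s f) (hb : 0 ≤ b)
    (h : ∀ z, z0 ≤ z → ‖∫ t in Ioi (0:ℝ), (f t : ℂ) * (uzSol κ z t)^2‖ ≤ C * Real.exp (-2*b*z)) :
    ∃ C z0 : ℝ, ∀ z, z0 ≤ z →
      |∫ t in Ioi (0:ℝ), f t * Real.exp (-2 * z * t)| ≤ C * Real.exp (-2 * b * z) := by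
  set M := ∫ t in Ioi (0:ℝ), ‖f t * Real.exp (-2 * s * t)‖ with hM
  have hMb : ∀ z, s ≤ z → |∫ t in Ioi (0:ℝ), f t * Real.exp (-2 * z * t)| ≤ M := by
    intro z hz
    rw [← Real.norm_eq_abs]
    refine (norm_integral_le_integral_norm _).trans ?_
    refine integral_mono_ae (hf.integrable_exp hz).norm (Integrable.norm hf) ?_
    refine (ae_restrict_mem measurableSet_Ioi).mono fun t ht => ?_
    have ht0 : (0:ℝ) < t := ht
    simp only
    rw [norm_mul, norm_mul]
    refine mul_le_mul_of_nonneg_left ?_ (norm_nonneg _)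
    rw [Real.norm_eq_abs, Real.norm_eq_abs, Real.abs_exp, Real.abs_exp]
    apply Real.exp_le_exp.2
    have := mul_nonneg (sub_nonneg.2 hz) ht0.le
    nlinarith
  have hM0 : 0 ≤ M := integral_nonneg fun t => norm_nonneg _
  have hC : 0 ≤ C := by
    have := (norm_nonneg _).trans (h z0 le_rfl)
    exact nonneg_of_mul_nonneg_left this (Real.exp_pos _)
  set z1 := max (max z0 1) (max (2*|κ|) s)
  have key : ∀ N : ℕ, ∀ z, z1 ≤ z → |∫ t in Ioi (0:ℝ), f t * Real.exp (-2 * z * t)| ≤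
      8 * C * Real.exp (-2*b*z) + M * (1/2)^N := by
    intro N
    induction N with
    | zero =>
      intro z hz
      have := hMb z (((le_max_right _ _).trans (le_max_right _ _)).trans hz)
      have : 0 ≤ 8 * C * Real.exp (-2*b*z) := by positivity
      simp only [pow_zero, mul_one]; linarith
    | succ N ih =>
      intro z hz
      have hz0 : z0 ≤ z := ((le_max_left _ _).trans (le_max_left _ _)).trans hz
      have hz1 : 1 ≤ z := ((le_max_right _ _).trans (le_max_left _ _)).trans hz
      have hzk : 2*|κ| ≤ z := ((le_max_left _ _).trans (le_max_right _ _)).trans hz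
      have hzs : s ≤ z := ((le_max_right _ _).trans (le_max_right _ _)).trans hz
      have := laplace_step hf hz1 hzk hzs (B := 8 * C * Real.exp (-2*b*z) + M * (1/2)^N) (by
        intro y hy
        refine (ih y (hz.trans hy)).trans ?_
        gcongr ?_ + _
        refine mul_le_mul_of_nonneg_left (Real.exp_le_exp.2 ?_) (by positivity)
        have := mul_nonneg hb (sub_nonneg.2 hy)
        nlinarith)
      have h2 := h z hz0
      have h3 : 0 ≤ C * Real.exp (-2*b*z) := by positivity
      have h4 : 0 ≤ M * (1/2)^N := by positivity
      rw [pow_succ]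
      nlinarith
  refine ⟨8 * C, z1, fun z hz => ?_⟩
  have hl : Tendsto (fun N : ℕ => 8 * C * Real.exp (-2*b*z) + M * (1/2:ℝ)^N) atTop
      (𝓝 (8 * C * Real.exp (-2*b*z) + M * 0)) :=
    ((tendsto_pow_atTop_nhds_zero_of_lt_one (by norm_num) (by norm_num)).const_mul M).const_add _
  rw [mul_zero, add_zero] at hl
  exact ge_of_tendsto' hl fun N => key N z hz

lemma IsPrim.congr_fun {P R p : ℝ → ℂ} {T : ℝ} (h : IsPrim P p T) (hT : 0 ≤ T)
    (hPR : ∀ t ∈ Icc 0 T, P t = R t) : IsPrim R p T :=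
  ⟨h.1, fun t ht => by rw [← hPR t ht, ← hPR 0 ⟨le_rfl, hT⟩]; exact h.2 t ht⟩

lemma MemA1.unit {Q : ℝ → ℝ} (hQ : MemA1 Q) {x : ℝ} (hx : 0 ≤ x) :
    IntervalIntegrable Q volume x (x+1) := by
  rw [intervalIntegrable_iff_integrableOn_Icc_of_le (by linarith)]
  exact hQ.2.1 x hx

lemma MemA1.nat {Q : ℝ → ℝ} (hQ : MemA1 Q) {x : ℝ} (hx : 0 ≤ x) (N : ℕ) :
    IntervalIntegrable Q volume x (x+N) := by
  induction N with
  | zero => simp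
  | succ N ih =>
    have := hQ.unit (x := x + N) (by positivity)
    rw [add_assoc] at this
    push_cast
    exact ih.trans this

lemma MemA1.intervalIntegrable {Q : ℝ → ℝ} (hQ : MemA1 Q) {T : ℝ} (hT : 0 ≤ T) :
    IntervalIntegrable Q volume 0 T := by
  obtain ⟨N, hN⟩ := exists_nat_ge T
  have := hQ.nat le_rfl N
  refine this.mono_set ?_
  rw [uIcc_of_le hT, uIcc_of_le (by simp)]
  exact Icc_subset_Icc le_rfl (by simpa using hN)

lemma MemA1.exists_bound {Q : ℝ → ℝ} (hQ : MemA1 Q) :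
    ∃ B : ℝ, 0 ≤ B ∧ ∀ x, 0 ≤ x → ∫ t in x..(x+1), |Q t| ≤ B := by
  obtain ⟨B, hB⟩ := hQ.2.2
  have h : ∀ x, 0 ≤ x → ∫ t in x..(x+1), |Q t| ≤ B := by
    intro x hx
    rw [intervalIntegral.integral_of_le (by linarith), ← integral_Icc_eq_integral_Ioc]
    exact hB ⟨⟨x, hx⟩, rfl⟩
  refine ⟨B, ?_, h⟩
  refine le_trans ?_ (h 0 le_rfl)
  exact intervalIntegral.integral_nonneg (by norm_num) fun _ _ => abs_nonneg _

/-- Exponentially weighted tail bound. -/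
lemma exp_tail {Q : ℝ → ℝ} (hQ : MemA1 Q) {B : ℝ} (hB0 : 0 ≤ B)
    (hB : ∀ x, 0 ≤ x → ∫ t in x..(x+1), |Q t| ≤ B) {z : ℝ} (hz : 1 ≤ z) {t : ℝ} (ht : 0 ≤ t) :
    IntegrableOn (fun s => Real.exp (-2*z*s) * Q s) (Ioi t) ∧
    ∫ s in Ioi t, ‖Real.exp (-2*z*s) * Q s‖ ≤ 2 * B * Real.exp (-2*z*t) := by
  have hcont : Continuous fun s => Real.exp (-2*z*s) := by fun_prop
  have hii : ∀ x, 0 ≤ x → ∀ N : ℕ,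
      IntervalIntegrable (fun s => Real.exp (-2*z*s) * Q s) volume x (x+N) := fun x hx N =>
    (hQ.nat hx N).continuousOn_mul hcont.continuousOn
  have hhalf : Real.exp (-2*z) ≤ 1/2 := by
    have h1 : Real.exp (-2*z) ≤ Real.exp (-1) := Real.exp_le_exp.2 (by linarith)
    have h2 : Real.exp (-1) ≤ 1/2 := by
      rw [Real.exp_neg, one_div]
      apply inv_anti₀ (by norm_num)
      have := Real.add_one_le_exp (1:ℝ); linarith
    linarith
  have key : ∀ N : ℕ, ∫ s in t..(t+N), ‖Real.exp (-2*z*s) * Q s‖ ≤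
      2 * B * Real.exp (-2*z*t) * (1 - (1/2)^N) := by
    intro N
    induction N with
    | zero => simp
    | succ N ih =>
      have i1 := (hii t ht N).norm
      have i2 := (hii (t+N) (by positivity) 1).norm
      rw [Nat.cast_one] at i2
      have : t + ((N+1:ℕ):ℝ) = t + N + 1 := by push_cast; ring
      rw [this, ← intervalIntegral.integral_add_adjacent_intervals i1 i2]
      have h3 : ∫ s in (t+N)..(t+N+1), ‖Real.exp (-2*z*s) * Q s‖ ≤
          ∫ s in (t+N)..(t+N+1), (Real.exp (-2*z*t) * (1/2)^N) * |Q s| := by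
        refine intervalIntegral.integral_mono_on (by linarith) i2
          ((hQ.unit (x := t+N) (by positivity)).abs.const_mul _) fun s hs => ?_
        rw [norm_mul, Real.norm_eq_abs, Real.norm_eq_abs, Real.abs_exp]
        refine mul_le_mul_of_nonneg_right ?_ (abs_nonneg _)
        calc Real.exp (-2*z*s) ≤ Real.exp (-2*z*(t+N)) := by
              apply Real.exp_le_exp.2; nlinarith [hs.1]
          _ = Real.exp (-2*z*t) * (Real.exp (-2*z))^N := by
              rw [← Real.exp_nat_mul, ← Real.exp_add]; congr 1; ring
          _ ≤ _ := by gcongr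
      rw [intervalIntegral.integral_const_mul] at h3
      have h4 := mul_le_mul_of_nonneg_left (hB (t+N) (by positivity))
        (by positivity : 0 ≤ Real.exp (-2*z*t) * (1/2)^N)
      rw [pow_succ]
      nlinarith
  have key2 : ∀ N : ℕ, ∫ s in t..(t+N), ‖Real.exp (-2*z*s) * Q s‖ ≤
      2 * B * Real.exp (-2*z*t) := fun N => by
    refine (key N).trans ?_
    have h1 : 0 ≤ 2 * B * Real.exp (-2*z*t) := by positivity
    have h2 : (0:ℝ) ≤ (1/2)^N := by positivity
    nlinarith
  have hb : Tendsto (fun N : ℕ => t + (N:ℝ)) atTop atTop :=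
    tendsto_atTop_add_const_left _ _ tendsto_natCast_atTop_atTop
  have hInt0 : IntegrableOn (fun s => Real.exp (-2*z*s) * Q s) (Ioi t) := by
    refine integrableOn_Ioi_of_intervalIntegral_norm_bounded (2 * B * Real.exp (-2*z*t)) t
      (fun N => ?_) hb (Eventually.of_forall key2)
    exact (intervalIntegrable_iff_integrableOn_Ioc_of_le (by simp)).1 (hii t ht N)
  refine ⟨hInt0, ?_⟩
  exact le_of_tendsto' (intervalIntegral_tendsto_integral_Ioi t hInt0.norm hb) key2

/-- clamp to `[-R,R]` -/
def clampR (R x : ℝ) : ℝ := max (-R) (min x R)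

lemma clampR_abs {R : ℝ} (hR : 0 ≤ R) (x : ℝ) : |clampR R x| ≤ R := by
  rw [abs_le]; exact ⟨le_max_left _ _, max_le (by linarith) (min_le_right _ _)⟩

lemma clampR_eq {R x : ℝ} (hx : |x| ≤ R) : clampR R x = x := by
  rw [abs_le] at hx
  rw [clampR, min_eq_left hx.2, max_eq_right hx.1]

lemma clampR_lip (R x y : ℝ) : |clampR R x - clampR R y| ≤ |x - y| := by
  unfold clampR
  refine (abs_max_sub_max_le_max _ _ _ _).trans ?_
  simp only [sub_self, abs_zero]
  refine max_le (abs_nonneg _) ?_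
  refine (abs_min_sub_min_le_max _ _ _ _).trans ?_
  simp

lemma clampR_cont (R : ℝ) : Continuous (clampR R) := by unfold clampR; fun_prop

lemma riccati {Q : ℝ → ℝ} (hQ : MemA1 Q) {B : ℝ} (hB0 : 0 ≤ B)
    (hB : ∀ x, 0 ≤ x → ∫ t in x..(x+1), |Q t| ≤ B) {R : ℝ} (hR : R = 2*B+1) {z : ℝ}
    (hz : 2*R^2 ≤ z) : ∃ q : ℝ → ℝ, Continuous q ∧ (∀ t, |q t| ≤ R) ∧
      IntegrableOn (fun s => Real.exp (-2*z*s) * (Q s - q s^2)) (Ioi 0) ∧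
      ∀ t, 0 ≤ t → q t = -(Real.exp (2*z*t) *
        ∫ s in Ioi t, Real.exp (-2*z*s) * (Q s - q s^2)) := by
  have hR1 : 1 ≤ R := by linarith
  have hz1 : 1 ≤ z := by nlinarith
  have hz0 : 0 < z := by linarith
  have hRz : 2 * R ≤ z := by nlinarith
  have hexp : ∀ t, IntegrableOn (fun s => Real.exp (-2*z*s)) (Ioi t) := fun t =>
    integrableOn_exp_mul_Ioi (by linarith) t
  have hexpI : ∀ t, ∫ s in Ioi t, Real.exp (-2*z*s) = Real.exp (-2*z*t) / (2*z) := fun t => by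
    rw [integral_exp_mul_Ioi (by linarith)]; field_simp
  -- bounded continuous perturbation
  have hpi : ∀ p : ℝ → ℝ, Continuous p → (∀ s, |p s| ≤ R) → ∀ t,
      IntegrableOn (fun s => Real.exp (-2*z*s) * p s^2) (Ioi t) := fun p hp hpR t => by
    have : Integrable (fun s => p s^2 * Real.exp (-2*z*s)) (volume.restrict (Ioi t)) := by
      refine Integrable.bdd_mul (c := R^2) (hexp t) (by fun_prop) (Eventually.of_forall fun s => ?_)
      rw [norm_pow, Real.norm_eq_abs]; gcongr; exact hpR s
    exact this.congr (Eventually.of_forall fun s => mul_comm _ _)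
  have hgi : ∀ p : ℝ → ℝ, Continuous p → (∀ s, |p s| ≤ R) → ∀ t, 0 ≤ t →
      IntegrableOn (fun s => Real.exp (-2*z*s) * (Q s - p s^2)) (Ioi t) := fun p hp hpR t ht => by
    have := (exp_tail hQ hB0 hB hz1 ht).1.sub (hpi p hp hpR t)
    refine this.congr (Eventually.of_forall fun s => ?_)
    simp only [Pi.sub_apply]; ring
  let S : (ℝ → ℝ) → ℝ → ℝ := fun p t => -(Real.exp (2*z*t) *
        ∫ s in Ioi t, Real.exp (-2*z*s) * (Q s - p s^2))
  have hSb : ∀ p : ℝ → ℝ, Continuous p → (∀ s, |p s| ≤ R) → ∀ t, 0 ≤ t → |S p t| ≤ R := by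
    intro p hp hpR t ht
    have h1 : |∫ s in Ioi t, Real.exp (-2*z*s) * (Q s - p s^2)| ≤
        2 * B * Real.exp (-2*z*t) + R^2 * (Real.exp (-2*z*t) / (2*z)) := by
      rw [← Real.norm_eq_abs]
      refine (norm_integral_le_integral_norm _).trans ?_
      have h2 := (exp_tail hQ hB0 hB hz1 ht)
      have h3 : ∫ s in Ioi t, ‖Real.exp (-2*z*s) * (Q s - p s^2)‖ ≤
          ∫ s in Ioi t, (‖Real.exp (-2*z*s) * Q s‖ + R^2 * Real.exp (-2*z*s)) := by
        refine integral_mono (hgi p hp hpR t ht).norm (h2.1.norm.add ((hexp t).const_mul _))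
          fun s => ?_
        simp only [norm_mul, Real.norm_eq_abs, Real.abs_exp]
        have h4 := abs_sub (Q s) (p s^2)
        have h5 : |p s^2| ≤ R^2 := by rw [abs_pow]; gcongr; exact hpR s
        have := Real.exp_pos (-2*z*s)
        nlinarith
      rw [integral_add h2.1.norm ((hexp t).const_mul _), integral_const_mul, hexpI] at h3
      linarith [h2.2]
    simp only [S]
    rw [abs_neg, abs_mul, Real.abs_exp]
    have h2 := mul_le_mul_of_nonneg_left h1 (Real.exp_pos (2*z*t)).le
    have h3 : Real.exp (2*z*t) * (2 * B * Real.exp (-2*z*t) + R^2 * (Real.exp (-2*z*t) / (2*z)))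
        = 2 * B + R^2/(2*z) := by
      have : Real.exp (2*z*t) * Real.exp (-2*z*t) = 1 := by
        rw [← Real.exp_add]; simp
      linear_combination (2*B + R^2/(2*z)) * this
    have h4 : R^2/(2*z) ≤ 1 := by rw [div_le_one (by linarith)]; linarith
    linarith
  have hSc : ∀ p : ℝ → ℝ, Continuous p → (∀ s, |p s| ≤ R) → Continuous fun t => S p (max t 0) := by
    intro p hp hpR
    have e : (fun t => S p (max t 0)) = fun t => -(Real.exp (2*z*(max t 0)) *
        ((∫ s in Ioi 0, Real.exp (-2*z*s) * (Q s - p s^2)) -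
          ∫ s in 0..(max t 0), (indicator (Ioi 0) fun s => Real.exp (-2*z*s) * (Q s - p s^2)) s)) := by
      funext t
      simp only [S]
      rw [← intervalIntegral.integral_interval_add_Ioi (hgi p hp hpR 0 le_rfl)
        (hgi p hp hpR (max t 0) (le_max_right _ _))]
      have : ∫ s in 0..(max t 0), (indicator (Ioi 0) fun s => Real.exp (-2*z*s) * (Q s - p s^2)) s
          = ∫ s in 0..(max t 0), Real.exp (-2*z*s) * (Q s - p s^2) := by
        rw [intervalIntegral.integral_of_le (le_max_right _ _),
          intervalIntegral.integral_of_le (le_max_right _ _)]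
        refine setIntegral_congr_fun measurableSet_Ioc fun s hs => ?_
        exact indicator_of_mem (show s ∈ Ioi 0 from hs.1) _
      rw [this]; ring_nf
    rw [e]
    have hind : Integrable (indicator (Ioi 0) fun s => Real.exp (-2*z*s) * (Q s - p s^2)) :=
      (integrable_indicator_iff measurableSet_Ioi).2 (hgi p hp hpR 0 le_rfl)
    have hcI : Continuous fun x : ℝ => ∫ s in 0..x,
        (indicator (Ioi 0) fun s => Real.exp (-2*z*s) * (Q s - p s^2)) s :=
      intervalIntegral.continuous_primitive (fun a b => hind.intervalIntegrable) 0
    have hm : Continuous fun t : ℝ => max t 0 := by fun_prop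
    have := hcI.comp hm
    simp only [Function.comp_def] at this
    fun_prop
  have hcc : ∀ q : BoundedContinuousFunction ℝ ℝ, Continuous fun s => clampR R (q s) := fun q =>
    (clampR_cont R).comp q.continuous
  have hcb : ∀ q : BoundedContinuousFunction ℝ ℝ, ∀ s, |clampR R (q s)| ≤ R := fun q s =>
    clampR_abs (by linarith) _
  let T : BoundedContinuousFunction ℝ ℝ → BoundedContinuousFunction ℝ ℝ := fun q =>
    BoundedContinuousFunction.ofNormedAddCommGroup
      (fun t => S (fun s => clampR R (q s)) (max t 0)) (hSc _ (hcc q) (hcb q)) R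
      (fun t => hSb _ (hcc q) (hcb q) _ (le_max_right _ _))
  have hT : ContractingWith (1/2) T := by
    refine ⟨by rw [← NNReal.coe_lt_coe]; norm_num, LipschitzWith.of_dist_le_mul fun q1 q2 => ?_⟩
    rw [BoundedContinuousFunction.dist_le (by positivity)]
    intro t
    rw [Real.dist_eq]
    set τ := max t 0 with hτ
    have hτ0 : 0 ≤ τ := le_max_right _ _
    set p1 := fun s => clampR R (q1 s)
    set p2 := fun s => clampR R (q2 s)
    set d := dist q1 q2
    change |S p1 τ - S p2 τ| ≤ _
    have e : S p1 τ - S p2 τ = Real.exp (2*z*τ) *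
        ∫ s in Ioi τ, Real.exp (-2*z*s) * (p1 s^2 - p2 s^2) := by
      have : ∫ s in Ioi τ, Real.exp (-2*z*s) * (p1 s^2 - p2 s^2) =
        (∫ s in Ioi τ, Real.exp (-2*z*s) * (Q s - p2 s^2)) -
          ∫ s in Ioi τ, Real.exp (-2*z*s) * (Q s - p1 s^2) := by
        rw [← integral_sub (hgi _ (hcc q2) (hcb q2) τ hτ0) (hgi _ (hcc q1) (hcb q1) τ hτ0)]
        refine integral_congr_ae (Eventually.of_forall fun s => ?_)
        simp only [p1, p2]; ring
      rw [this]; simp only [S]; ring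
    have h1 : |∫ s in Ioi τ, Real.exp (-2*z*s) * (p1 s^2 - p2 s^2)| ≤
        (2*R*d) * (Real.exp (-2*z*τ) / (2*z)) := by
      rw [← Real.norm_eq_abs, ← hexpI, ← integral_const_mul]
      refine norm_integral_le_of_norm_le ((hexp τ).const_mul _) (Eventually.of_forall fun s => ?_)
      rw [norm_mul, Real.norm_eq_abs, Real.norm_eq_abs, Real.abs_exp, mul_comm]
      refine mul_le_mul_of_nonneg_right ?_ (Real.exp_pos _).le
      rw [sq_sub_sq, abs_mul]
      have h2 : |p1 s + p2 s| ≤ 2*R := by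
        refine (abs_add_le _ _).trans ?_
        have := hcb q1 s; have := hcb q2 s; simp only [p1, p2]; linarith
      have h3 : |p1 s - p2 s| ≤ d := by
        refine (clampR_lip R _ _).trans ?_
        rw [← Real.dist_eq]; exact BoundedContinuousFunction.dist_coe_le_dist s
      gcongr
    rw [e, abs_mul, Real.abs_exp]
    have h2 := mul_le_mul_of_nonneg_left h1 (Real.exp_pos (2*z*τ)).le
    have h3 : Real.exp (2*z*τ) * ((2*R*d) * (Real.exp (-2*z*τ) / (2*z))) = (R/z) * d := by
      have : Real.exp (2*z*τ) * Real.exp (-2*z*τ) = 1 := by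
        rw [← Real.exp_add]; simp
      linear_combination (R/z*d) * this
    have h4 : R / z ≤ 1/2 := by rw [div_le_iff₀ hz0]; linarith
    have hd : 0 ≤ d := dist_nonneg
    have h5 := mul_le_mul_of_nonneg_right h4 hd
    have h6 : ((1/2 : NNReal) : ℝ) = 1/2 := by norm_num
    rw [h6]
    linarith
  set q := hT.fixedPoint with hq
  have hfix : T q = q := hT.fixedPoint_isFixedPt
  have hqT : ∀ t, q t = S (fun s => clampR R (q s)) (max t 0) := fun t => by
    conv_lhs => rw [← hfix]
    rfl
  have hqR : ∀ t, |q t| ≤ R := fun t => by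
    rw [hqT]; exact hSb _ (hcc q) (hcb q) _ (le_max_right _ _)
  have hcl : (fun s => clampR R (q s)) = q := funext fun s => clampR_eq (hqR s)
  rw [hcl] at hqT
  refine ⟨q, q.continuous, hqR, hgi q q.continuous hqR 0 le_rfl, fun t ht => ?_⟩
  have := hqT t
  rw [max_eq_left ht] at this
  exact this

lemma weyl_exists {Q : ℝ → ℝ} (hQ : MemA1 Q) : ∃ R z1 : ℝ, 0 ≤ R ∧ ∀ z, z1 ≤ z →
    ∃ v w : ℝ → ℂ, SolutionPair Q (z:ℂ) v w ∧ v 0 = 1 ∧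
      (∀ T, 0 ≤ T → IsPrim v w T ∧ IsPrim w (fun t => ((Q t : ℂ) + (z:ℂ)^2) * v t) T) ∧
      ∀ t, 0 ≤ t → ‖v t‖ ≤ Real.exp (-(z-R)*t) ∧ ‖w t‖ ≤ (z+R) * ‖v t‖ := by
  obtain ⟨B, hB0, hB⟩ := hQ.exists_bound
  refine ⟨2*B+1, 2*(2*B+1)^2, by linarith, fun z hz => ?_⟩
  obtain ⟨q, hqc, hqR, hgi, hq⟩ := riccati hQ hB0 hB rfl hz
  set R := 2*B+1 with hR
  have hR1 : 1 ≤ R := by linarith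
  have hz0 : 0 < z := by nlinarith
  have hRz : R < z := by nlinarith
  let L : ℝ → ℝ := fun t => ∫ s in (0:ℝ)..t, (-z + q s)
  have hLd : ∀ t, HasDerivAt L (-z + q t) t := fun t =>
    (by fun_prop : Continuous fun s => -z + q s).integral_hasStrictDerivAt 0 t |>.hasDerivAt
  let v : ℝ → ℂ := fun t => Complex.exp (L t)
  let w : ℝ → ℂ := fun t => ((-z + q t : ℝ):ℂ) * v t
  have hvd : ∀ t, HasDerivAt v (w t) t := fun t => by
    have := (hLd t).ofReal_comp.cexp
    simp only [w, v]
    rw [mul_comm]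
    exact this
  have hvc : Continuous v := continuous_iff_continuousAt.2 fun t => (hvd t).continuousAt
  have hwc : Continuous w := by
    simp only [w]; fun_prop
  have hv0 : v 0 = 1 := by simp [v, L]
  have hP1 : ∀ T, IsPrim v w T := fun T => IsPrim.of_hasDerivAt hvd hwc
  have hP2 : ∀ T, 0 ≤ T → IsPrim w (fun t => ((Q t : ℂ) + (z:ℂ)^2) * v t) T := by
    intro T hT
    set g : ℝ → ℝ := fun s => Real.exp (-2*z*s) * (Q s - q s^2) with hg
    set I := ∫ s in Ioi (0:ℝ), g s
    have hgii : IntervalIntegrable g volume 0 T :=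
      (intervalIntegrable_iff_integrableOn_Ioc_of_le hT).2 (hgi.mono_set Ioc_subset_Ioi_self)
    have p1 : IsPrim (fun t => ((-(I - ∫ s in (0:ℝ)..t, g s) : ℝ) : ℂ)) (fun t => (g t : ℂ)) T := by
      refine ⟨⟨hgii.1.ofReal, hgii.2.ofReal⟩, fun t ht => ?_⟩
      rw [intervalIntegral.integral_ofReal]
      simp
      ring
    have p2 : IsPrim (fun t => ((Real.exp (2*z*t) : ℝ) : ℂ))
        (fun t => ((Real.exp (2*z*t) * (2*z) : ℝ):ℂ)) T := by
      refine IsPrim.of_hasDerivAt (fun t => ?_) (by fun_prop)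
      have : HasDerivAt (fun t => Real.exp (2*z*t)) (Real.exp (2*z*t) * (2*z)) t := by
        have := ((hasDerivAt_id t).const_mul (2*z)).exp
        simpa using this
      exact this.ofReal_comp
    have hqe : ∀ t ∈ Icc 0 T, q t = Real.exp (2*z*t) * (-(I - ∫ s in (0:ℝ)..t, g s)) := by
      intro t ht
      rw [hq t ht.1]
      have := intervalIntegral.integral_interval_add_Ioi hgi
        (hgi.mono_set (Ioi_subset_Ioi ht.1))
      simp only [I]
      rw [← this]; ring
    have p3 : IsPrim (fun t => (q t : ℂ)) (fun t => ((2*z*q t + Q t - q t^2 : ℝ):ℂ)) T := by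
      refine ((p2.mul p1 hT).congr (fun t ht => ?_) hT).congr_fun hT (fun t ht => ?_)
      · have := hqe t ht
        have e1 : Real.exp (2*z*t) * g t = Q t - q t^2 := by
          have : Real.exp (2*z*t) * Real.exp (-2*z*t) = 1 := by
            rw [← Real.exp_add]; simp
          simp only [hg]
          linear_combination (Q t - q t^2) * this
        rw [← Complex.ofReal_mul, ← Complex.ofReal_mul, ← Complex.ofReal_add]
        congr 1
        rw [e1]
        linear_combination (-2*z) * this
      · rw [← Complex.ofReal_mul, ← hqe t ht]
    have p4 : IsPrim (fun t => ((-z + q t : ℝ) : ℂ)) (fun t => ((2*z*q t + Q t - q t^2 : ℝ):ℂ)) T := by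
      refine ⟨p3.1, fun t ht => ?_⟩
      have := p3.2 t ht
      simp only at this
      push_cast at this ⊢
      rw [this]; ring
    refine (p4.mul (hP1 T) hT).congr (fun t ht => ?_) hT
    simp only [w]
    push_cast
    ring
  have hvn : ∀ t, 0 ≤ t → ‖v t‖ ≤ Real.exp (-(z-R)*t) := by
    intro t ht
    simp only [v]
    rw [Complex.norm_exp, Complex.ofReal_re]
    apply Real.exp_le_exp.2
    have : L t ≤ ∫ s in (0:ℝ)..t, -(z-R) := by
      refine intervalIntegral.integral_mono_on ht
        ((by fun_prop : Continuous fun s => -z + q s).intervalIntegrable _ _)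
        (by simp) fun s _ => ?_
      have := (abs_le.1 (hqR s)).2
      linarith
    rw [intervalIntegral.integral_const, smul_eq_mul] at this
    linarith
  refine ⟨v, w, ⟨?_, fun t ht => (hP1 t).1, fun t ht => (hP2 t ht).1, fun t ht => ?_, fun t ht => ?_⟩,
    hv0, fun T hT => ⟨hP1 T, hP2 T hT⟩, fun t ht => ⟨hvn t ht, ?_⟩⟩
  · refine Integrable.mono' (g := fun t => Real.exp ((-2*(z-R))*t))
      (integrableOn_exp_mul_Ioi (by linarith) 0) (by fun_prop) ?_
    refine (ae_restrict_mem measurableSet_Ioi).mono fun t ht => ?_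
    have h1 := hvn t (le_of_lt ht)
    rw [Real.norm_of_nonneg (by positivity)]
    calc ‖v t‖^2 ≤ (Real.exp (-(z-R)*t))^2 := by gcongr
      _ = _ := by rw [← Real.exp_nat_mul]; congr 1; push_cast; ring
  · rw [← hv0]; exact (hP1 t).2 t ⟨ht, le_rfl⟩
  · exact (hP2 t ht).2 t ⟨ht, le_rfl⟩
  · simp only [w]
    rw [norm_mul, Complex.norm_real, Real.norm_eq_abs]
    refine mul_le_mul_of_nonneg_right ?_ (norm_nonneg _)
    refine (abs_add_le _ _).trans ?_
    rw [abs_neg, abs_of_pos hz0]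
    linarith [hqR t]

lemma amp_integrable {κ s : ℝ} {f : ℝ → ℝ} (hf : MemL1s s f) {z : ℝ} (hz : 1 ≤ z)
    (hk : 2 * |κ| ≤ z) (hs : s ≤ z) :
    IntegrableOn (fun t => (f t : ℂ) * (uzSol κ z t)^2) (Ioi 0) := by
  obtain ⟨D, c, hD1, hD2, hc0, hc, hu⟩ := uz_expand κ hz hk
  have hcont : ContinuousOn (fun t => ∑' n, c n * (Real.exp (-2*t))^n) (Ioi 0) := by
    refine continuousOn_tsum (u := fun n => (1/4:ℝ)^n) (fun n => by fun_prop)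
      (summable_geometric_of_lt_one (by norm_num) (by norm_num)) fun n t ht => ?_
    have ht0 : (0:ℝ) < t := ht
    rw [norm_mul, norm_pow, Real.norm_eq_abs, Real.norm_eq_abs, Real.abs_exp]
    have : Real.exp (-2*t) ≤ 1 := by rw [Real.exp_le_one_iff]; linarith
    calc |c n| * Real.exp (-2*t)^n ≤ (1/4)^n * 1 :=
          mul_le_mul (hc n) (pow_le_one₀ (Real.exp_pos _).le this) (by positivity) (by positivity)
        _ = _ := mul_one _
  have h1 : Integrable (fun t => (D * ∑' n, c n * (Real.exp (-2*t))^n) *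
      (f t * Real.exp (-2*z*t))) (volume.restrict (Ioi 0)) := by
    refine Integrable.bdd_mul (c := D * (4/3)) (hf.integrable_exp hs)
      ((continuousOn_const.mul hcont).aestronglyMeasurable measurableSet_Ioi) ?_
    refine (ae_restrict_mem measurableSet_Ioi).mono fun t ht => ?_
    have ht0 : (0:ℝ) < t := ht
    rw [norm_mul, Real.norm_of_nonneg (by linarith)]
    refine mul_le_mul_of_nonneg_left ?_ (by linarith)
    exact tsum_c_bound hc (Real.exp_pos (-2*t)).le (by rw [Real.exp_le_one_iff]; linarith)
  refine h1.ofReal.congr ?_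
  refine (ae_restrict_mem measurableSet_Ioi).mono fun t ht => ?_
  have ht0 : (0:ℝ) < t := ht
  simp only
  rw [hu t ht0.le]
  generalize (∑' n, c n * (Real.exp (-2*t))^n) = Y
  generalize Real.exp (-2*z*t) = X
  simp only [Complex.coe_algebraMap, Complex.ofReal_mul]
  push_cast
  ring

lemma amp_diff {κ s : ℝ} {Q₁ Q₂ A₁ A₂ : ℝ → ℝ} (hA1 : IsAmplitude κ Q₁ s A₁)
    (hA2 : IsAmplitude κ Q₂ s A₂) {z : ℝ} (hz : 1 ≤ z) (hk : 2 * |κ| ≤ z) (hs : s ≤ z)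
    {v1 w1 v2 w2 : ℝ → ℂ} (h1 : SolutionPair Q₁ z v1 w1) (h2 : SolutionPair Q₂ z v2 w2) :
    ∫ t in Ioi (0:ℝ), ((A₁ t - A₂ t : ℝ) : ℂ) * (uzSol κ z t)^2 = w1 0 - w2 0 := by
  have e1 := hA1.2 z hs v1 w1 h1
  have e2 := hA2.2 z hs v2 w2 h2
  have : ∫ t in Ioi (0:ℝ), ((A₁ t - A₂ t : ℝ) : ℂ) * (uzSol κ z t)^2 =
      (∫ t in Ioi (0:ℝ), (A₁ t : ℂ) * (uzSol κ z t)^2) -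
        ∫ t in Ioi (0:ℝ), (A₂ t : ℂ) * (uzSol κ z t)^2 := by
    rw [← integral_sub (amp_integrable hA1.1 hz hk hs) (amp_integrable hA2.1 hz hk hs)]
    refine integral_congr_ae (Eventually.of_forall fun t => ?_)
    simp only
    push_cast; ring
  rw [this, ← e1, ← e2]; ring

lemma memL1s_sub {s : ℝ} {A₁ A₂ : ℝ → ℝ} (h1 : MemL1s s A₁) (h2 : MemL1s s A₂) :
    MemL1s s (fun t => A₁ t - A₂ t) := by
  refine (Integrable.sub h1 h2).congr (Eventually.of_forall fun t => ?_)
  simp only [Pi.sub_apply]; ring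

/-- Equal potentials give equal amplitudes. -/
lemma amp_of_pot {κ a s : ℝ} (ha : 0 < a) {Q₁ Q₂ A₁ A₂ : ℝ → ℝ} (hQA1 : MemA1 Q₁)
    (hQA2 : MemA1 Q₂) (hA1 : IsAmplitude κ Q₁ s A₁) (hA2 : IsAmplitude κ Q₂ s A₂)
    (h : ∀ᵐ t, t ∈ Ioo 0 a → Q₁ t = Q₂ t) : ∀ᵐ t, t ∈ Ioo 0 a → A₁ t = A₂ t := by
  have hf := memL1s_sub hA1.1 hA2.1
  obtain ⟨R1, y1, hR1, H1⟩ := weyl_exists hQA1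
  obtain ⟨R2, y2, hR2, H2⟩ := weyl_exists hQA2
  have main : ∀ᵐ t, t ∈ Ioo 0 a → A₁ t - A₂ t = 0 := by
    refine laplace_ae_zero hf (fun b hb => ?_) ha
    set δ := 2 * (a - b) with hδ
    have hδ0 : 0 < δ := by have := hb.2; simp only [hδ]; linarith
    refine laplace_of_amp (κ := κ) (z0 := max (max y1 y2) (max (max 1 (2*|κ|)) s))
      (C := (2/δ + (R1+R2)) * Real.exp ((R1+R2)*a)) hf hb.1.le (fun z hz => ?_)
    have hzy1 : y1 ≤ z := (le_max_left _ _).trans ((le_max_left _ _).trans hz)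
    have hzy2 : y2 ≤ z := (le_max_right _ _).trans ((le_max_left _ _).trans hz)
    have hz1 : 1 ≤ z := (le_max_left _ _).trans
      ((le_max_left _ _).trans ((le_max_right _ _).trans hz))
    have hzk : 2*|κ| ≤ z := (le_max_right _ _).trans
      ((le_max_left _ _).trans ((le_max_right _ _).trans hz))
    have hzs : s ≤ z := (le_max_right _ _).trans ((le_max_right _ _).trans hz)
    obtain ⟨v1, w1, hsp1, hv1, hp1, hb1⟩ := H1 z hzy1
    obtain ⟨v2, w2, hsp2, hv2, hp2, hb2⟩ := H2 z hzy2
    rw [amp_diff hA1 hA2 hz1 hzk hzs hsp1 hsp2]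
    obtain ⟨pv1, pw1⟩ := hp1 a ha.le
    obtain ⟨pv2, pw2⟩ := hp2 a ha.le
    have pW := (pw1.mul pv2 ha.le).sub (pw2.mul pv1 ha.le) ha.le
    have e := pW.2 a ⟨ha.le, le_rfl⟩
    have hzero : ∫ x in (0:ℝ)..a, ((((Q₁ x : ℂ) + (z:ℂ)^2) * v1 x) * v2 x + w1 x * w2 x -
        ((((Q₂ x : ℂ) + (z:ℂ)^2) * v2 x) * v1 x + w2 x * w1 x)) = 0 := by
      rw [intervalIntegral.integral_of_le ha.le, integral_Ioc_eq_integral_Ioo]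
      rw [setIntegral_congr_ae (g := fun _ => (0:ℂ)) measurableSet_Ioo]
      · simp
      · filter_upwards [h] with t ht htm
        rw [ht htm]; ring
    rw [hzero] at e
    simp only [hv1, hv2, mul_one, add_zero] at e
    rw [← e]
    obtain ⟨n1, m1⟩ := hb1 a ha.le
    obtain ⟨n2, m2⟩ := hb2 a ha.le
    have hz0 : 0 < z := by linarith
    have hprod : ‖v1 a‖ * ‖v2 a‖ ≤ Real.exp (-2*a*z) * Real.exp ((R1+R2)*a) := by
      calc ‖v1 a‖ * ‖v2 a‖ ≤ Real.exp (-(z-R1)*a) * Real.exp (-(z-R2)*a) := by gcongr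
        _ = _ := by rw [← Real.exp_add, ← Real.exp_add]; congr 1; ring
    have hn : ‖w1 a * v2 a - w2 a * v1 a‖ ≤ (2*z + (R1+R2)) * (‖v1 a‖ * ‖v2 a‖) := by
      refine (norm_sub_le _ _).trans ?_
      rw [norm_mul, norm_mul]
      have := mul_le_mul_of_nonneg_right m1 (norm_nonneg (v2 a))
      have := mul_le_mul_of_nonneg_right m2 (norm_nonneg (v1 a))
      nlinarith
    have hexp : Real.exp (-2*a*z) * (2*z + (R1+R2)) ≤ (2/δ + (R1+R2)) * Real.exp (-2*b*z) := by
      have e1 : Real.exp (-2*a*z) = Real.exp (-2*b*z) * Real.exp (-(δ*z)) := by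
        rw [← Real.exp_add]; congr 1; simp only [hδ]; ring
      have e2 : Real.exp (-(δ*z)) * (2*z + (R1+R2)) ≤ 2/δ + (R1+R2) := by
        have h1 : Real.exp (-(δ*z)) ≤ 1 := by
          rw [Real.exp_le_one_iff]; nlinarith
        have h2 : Real.exp (-(δ*z)) * (δ*z) ≤ 1 := by
          have h3 := Real.add_one_le_exp (δ*z)
          have h4 : Real.exp (-(δ*z)) * Real.exp (δ*z) = 1 := by rw [← Real.exp_add]; simp
          have h5 := Real.exp_pos (-(δ*z))
          nlinarith
        have h3 : Real.exp (-(δ*z)) * (2*z) ≤ 2/δ := by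
          rw [le_div_iff₀ hδ0]; nlinarith
        have h4 : Real.exp (-(δ*z)) * (R1+R2) ≤ R1+R2 := by nlinarith
        nlinarith
      rw [e1, mul_assoc, mul_comm]
      exact mul_le_mul_of_nonneg_right e2 (Real.exp_pos _).le
    calc ‖w1 a * v2 a - w2 a * v1 a‖ ≤ (2*z + (R1+R2)) * (‖v1 a‖ * ‖v2 a‖) := hn
      _ ≤ (2*z + (R1+R2)) * (Real.exp (-2*a*z) * Real.exp ((R1+R2)*a)) := by
          gcongr
      _ = (Real.exp (-2*a*z) * (2*z + (R1+R2))) * Real.exp ((R1+R2)*a) := by ring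
      _ ≤ ((2/δ + (R1+R2)) * Real.exp (-2*b*z)) * Real.exp ((R1+R2)*a) := by gcongr
      _ = _ := by ring
  filter_upwards [main] with t ht htm
  linarith [ht htm]

/-- Equal amplitudes on `(0,a)` make the m-functions exponentially close. -/
lemma m_close {κ a s : ℝ} (ha : 0 < a) {Q₁ Q₂ A₁ A₂ : ℝ → ℝ}
    (hA1 : IsAmplitude κ Q₁ s A₁) (hA2 : IsAmplitude κ Q₂ s A₂)
    (h : ∀ᵐ t, t ∈ Ioo 0 a → A₁ t = A₂ t) : ∃ C, ∀ z, 1 ≤ z → 2 * |κ| ≤ z → s ≤ z →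
    ∀ v1 w1 v2 w2 : ℝ → ℂ, SolutionPair Q₁ z v1 w1 → SolutionPair Q₂ z v2 w2 →
    ‖w1 0 - w2 0‖ ≤ C * Real.exp (-2*a*z) := by
  have hf := memL1s_sub hA1.1 hA2.1
  refine ⟨6 * Real.exp (2*s*a) *
    ∫ t in Ioi (0:ℝ), ‖(A₁ t - A₂ t) * Real.exp (-2*s*t)‖, ?_⟩
  intro z hz hk hs v1 w1 v2 w2 h1 h2
  rw [← amp_diff hA1 hA2 hz hk hs h1 h2]
  have : 6 * Real.exp (2*s*a) * (∫ t in Ioi (0:ℝ), ‖(A₁ t - A₂ t) * Real.exp (-2*s*t)‖) *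
      Real.exp (-2*a*z) = ∫ t in Ioi (0:ℝ), (6 * Real.exp (2*s*a) * Real.exp (-2*a*z)) *
        ‖(A₁ t - A₂ t) * Real.exp (-2*s*t)‖ := by
    rw [integral_const_mul]; ring
  rw [this]
  refine norm_integral_le_of_norm_le ((Integrable.norm hf).const_mul _) ?_
  have hne : ∀ᵐ t : ℝ, t ≠ a := by simp [ae_iff, measure_singleton]
  filter_upwards [ae_restrict_mem measurableSet_Ioi, ae_restrict_of_ae h, ae_restrict_of_ae hne]
    with t ht hA hta
  have ht0 : (0:ℝ) < t := ht
  rcases lt_or_gt_of_ne hta with hlt | hgt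
  · rw [hA ⟨ht0, hlt⟩]; simp
  · have hb := uz_bound κ hz hk ht0.le
    rw [norm_mul, norm_mul, Complex.norm_real]
    rw [Real.norm_eq_abs (Real.exp _), Real.abs_exp]
    have : Real.exp (-2*z*t) ≤ Real.exp (2*s*a) * Real.exp (-2*a*z) * Real.exp (-2*s*t) := by
      rw [← Real.exp_add, ← Real.exp_add]
      apply Real.exp_le_exp.2
      nlinarith [mul_nonneg (sub_nonneg.2 hs) (sub_nonneg.2 hgt.le)]
    calc ‖A₁ t - A₂ t‖ * ‖(uzSol κ z t)^2‖ ≤ ‖A₁ t - A₂ t‖ *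
          (6 * (Real.exp (2*s*a) * Real.exp (-2*a*z) * Real.exp (-2*s*t))) := by
            refine mul_le_mul_of_nonneg_left (hb.trans ?_) (norm_nonneg _)
            linarith
      _ = _ := by ring

lemma hasSum_mul_integral {q : ℝ → ℂ} {T : ℝ} (hT : 0 ≤ T) (hq : IntervalIntegrable q volume 0 T)
    {G : ℕ → ℝ → ℂ} (hG : ∀ n, ContinuousOn (G n) (Icc 0 T)) {c : ℕ → ℝ} (hc : Summable c)
    (hb : ∀ n, ∀ t ∈ Icc 0 T, ‖G n t‖ ≤ c n) :
    HasSum (fun n => ∫ t in (0:ℝ)..T, q t * G n t) (∫ t in (0:ℝ)..T, q t * ∑' n, G n t) := by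
  have hsub : uIoc 0 T ⊆ Icc 0 T := by rw [uIoc_of_le hT]; exact Ioc_subset_Icc_self
  refine intervalIntegral.hasSum_integral_of_dominated_convergence (fun n t => ‖q t‖ * c n)
    (fun n => ?_) (fun n => ?_) ?_ ?_ ?_
  · have : IntervalIntegrable (fun t => q t * G n t) volume 0 T :=
      hq.mul_continuousOn (by rw [uIcc_of_le hT]; exact hG n)
    exact (intervalIntegrable_iff.1 this).aestronglyMeasurable
  · refine Eventually.of_forall fun t ht => ?_
    rw [norm_mul]
    exact mul_le_mul_of_nonneg_left (hb n t (hsub ht)) (norm_nonneg _)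
  · exact Eventually.of_forall fun t _ => hc.mul_left _
  · simp_rw [tsum_mul_left]
    exact hq.norm.mul_const _
  · refine Eventually.of_forall fun t ht => HasSum.mul_left _ (Summable.hasSum ?_)
    exact Summable.of_norm_bounded hc fun n => hb n t (hsub ht)

/-- Picard iterates. -/
noncomputable def Yit (Q : ℝ → ℂ) (α β : ℂ) : ℕ → ℂ → ℝ → ℂ
  | 0 => fun _ t => α + β * t
  | n + 1 => fun l t => ∫ s in (0:ℝ)..t, ∫ r in (0:ℝ)..s, (Q r + l) * Yit Q α β n l r

lemma prim_cont {q : ℝ → ℂ} {a : ℝ} (ha : 0 ≤ a) (hq : IntervalIntegrable q volume 0 a) :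
    ContinuousOn (fun t => ∫ s in (0:ℝ)..t, q s) (Icc 0 a) := by
  have := intervalIntegral.continuousOn_primitive_interval' hq (left_mem_uIcc)
  rwa [uIcc_of_le ha] at this

lemma II_mul {q f : ℝ → ℂ} {a : ℝ} (ha : 0 ≤ a) (hq : IntervalIntegrable q volume 0 a)
    (hf : ContinuousOn f (Icc 0 a)) : IntervalIntegrable (fun t => q t * f t) volume 0 a :=
  hq.mul_continuousOn (by rwa [uIcc_of_le ha])

lemma II_cont {f : ℝ → ℂ} {a : ℝ} (ha : 0 ≤ a)
    (hf : ContinuousOn f (Icc 0 a)) : IntervalIntegrable f volume 0 a :=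
  ContinuousOn.intervalIntegrable (by rwa [uIcc_of_le ha])

lemma II_mono {f : ℝ → ℂ} {a t : ℝ} (hf : IntervalIntegrable f volume 0 a) (ht : t ∈ Icc 0 a) :
    IntervalIntegrable f volume 0 t := by
  refine hf.mono_set ?_
  rw [uIcc_of_le ht.1, uIcc_of_le (ht.1.trans ht.2)]
  exact Icc_subset_Icc le_rfl ht.2

lemma dbl_cont {q f : ℝ → ℂ} {a : ℝ} (ha : 0 ≤ a) (hq : IntervalIntegrable q volume 0 a)
    (hf : ContinuousOn f (Icc 0 a)) :
    ContinuousOn (fun t => ∫ s in (0:ℝ)..t, ∫ r in (0:ℝ)..s, q r * f r) (Icc 0 a) :=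
  prim_cont ha (II_cont ha (prim_cont ha (II_mul ha hq hf)))

lemma dbl_add {q p f g : ℝ → ℂ} {a : ℝ} (ha : 0 ≤ a) (hq : IntervalIntegrable q volume 0 a)
    (hp : IntervalIntegrable p volume 0 a)
    (hf : ContinuousOn f (Icc 0 a)) (hg : ContinuousOn g (Icc 0 a)) {t : ℝ} (ht : t ∈ Icc 0 a) :
    ∫ s in (0:ℝ)..t, ∫ r in (0:ℝ)..s, (q r * f r + p r * g r) =
    (∫ s in (0:ℝ)..t, ∫ r in (0:ℝ)..s, q r * f r) +
      ∫ s in (0:ℝ)..t, ∫ r in (0:ℝ)..s, p r * g r := by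
  have i1 := II_mono (II_cont ha (prim_cont ha (II_mul ha hq hf))) ht
  have i2 := II_mono (II_cont ha (prim_cont ha (II_mul ha hp hg))) ht
  rw [← intervalIntegral.integral_add i1 i2]
  refine intervalIntegral.integral_congr fun s hs => ?_
  rw [uIcc_of_le ht.1] at hs
  have hs' : s ∈ Icc 0 a := ⟨hs.1, hs.2.trans ht.2⟩
  exact intervalIntegral.integral_add (II_mono (II_mul ha hq hf) hs')
    (II_mono (II_mul ha hp hg) hs')

lemma dbl_sum {q : ℝ → ℂ} {a : ℝ} (ha : 0 ≤ a) (hq : IntervalIntegrable q volume 0 a)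
    (N : ℕ) (C : ℕ → ℝ → ℂ) (b : ℕ → ℂ) (hC : ∀ k, ContinuousOn (C k) (Icc 0 a))
    {t : ℝ} (ht : t ∈ Icc 0 a) :
    ∫ s in (0:ℝ)..t, ∫ r in (0:ℝ)..s, q r * ∑ k ∈ Finset.range N, b k * C k r =
    ∑ k ∈ Finset.range N, b k * ∫ s in (0:ℝ)..t, ∫ r in (0:ℝ)..s, q r * C k r := by
  induction N with
  | zero => simp
  | succ N ih =>
    rw [Finset.sum_range_succ, ← ih]
    simp_rw [Finset.sum_range_succ, mul_add]
    rw [dbl_add ha hq hq (continuousOn_finsetSum _ fun k _ => (hC k).const_mul (b k))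
      ((hC N).const_mul (b N)) ht]
    congr 1
    simp_rw [mul_left_comm _ (b N), intervalIntegral.integral_const_mul]

lemma Yit_poly {Q : ℝ → ℂ} {a : ℝ} (ha : 0 ≤ a) (hQ : IntervalIntegrable Q volume 0 a) (α β : ℂ)
    (n : ℕ) : ∃ (N : ℕ) (C : ℕ → ℝ → ℂ), (∀ k, ContinuousOn (C k) (Icc 0 a)) ∧
      ∀ l, ∀ t ∈ Icc 0 a, Yit Q α β n l t = ∑ k ∈ Finset.range N, l^k * C k t := by
  induction n with
  | zero =>
    refine ⟨1, fun _ t => α + β * t, fun k => by fun_prop, fun l t ht => ?_⟩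
    simp [Yit]
  | succ n ih =>
    obtain ⟨N, C, hC, hY⟩ := ih
    have h1 : IntervalIntegrable (fun _ : ℝ => (1:ℂ)) volume 0 a := by simp
    refine ⟨N+1, fun k t => (if k < N then ∫ s in (0:ℝ)..t, ∫ r in (0:ℝ)..s, Q r * C k r else 0) +
      (if k = 0 then 0 else ∫ s in (0:ℝ)..t, ∫ r in (0:ℝ)..s, 1 * C (k-1) r), fun k => ?_,
      fun l t ht => ?_⟩
    · refine ContinuousOn.add ?_ ?_
      · split_ifs
        · exact dbl_cont ha hQ (hC k)
        · exact continuousOn_const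
      · split_ifs
        · exact continuousOn_const
        · exact dbl_cont ha h1 (hC _)
    · have e1 : Yit Q α β (n+1) l t = ∫ s in (0:ℝ)..t, ∫ r in (0:ℝ)..s,
          (Q r * (∑ k ∈ Finset.range N, l^k * C k r) +
            1 * ∑ k ∈ Finset.range N, l^(k+1) * C k r) := by
        rw [Yit]
        refine intervalIntegral.integral_congr fun s hs => ?_
        rw [uIcc_of_le ht.1] at hs
        refine intervalIntegral.integral_congr fun r hr => ?_
        rw [uIcc_of_le hs.1] at hr
        rw [hY l r ⟨hr.1, hr.2.trans (hs.2.trans ht.2)⟩, add_mul]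
        congr 1
        rw [one_mul, Finset.mul_sum]
        exact Finset.sum_congr rfl fun k _ => by ring
      rw [e1, dbl_add ha hQ h1 (continuousOn_finsetSum _ fun k _ => (hC k).const_mul _)
        (continuousOn_finsetSum _ fun k _ => (hC k).const_mul _) ht, dbl_sum ha hQ N C _ hC ht,
        dbl_sum ha h1 N C _ hC ht]
      simp_rw [mul_add, Finset.sum_add_distrib]
      congr 1
      · rw [Finset.sum_range_succ]
        simp only [lt_self_iff_false, if_false, mul_zero, add_zero]
        exact Finset.sum_congr rfl fun k hk => by rw [if_pos (Finset.mem_range.1 hk)]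
      · rw [Finset.sum_range_succ']
        simp

lemma Yit_cont {Q : ℝ → ℂ} {a : ℝ} (ha : 0 ≤ a) (hQ : IntervalIntegrable Q volume 0 a) (α β : ℂ)
    (n : ℕ) (l : ℂ) : ContinuousOn (Yit Q α β n l) (Icc 0 a) := by
  obtain ⟨N, C, hC, hY⟩ := Yit_poly ha hQ α β n
  refine ContinuousOn.congr (f := fun t => ∑ k ∈ Finset.range N, l^k * C k t) ?_ (hY l)
  exact continuousOn_finsetSum _ fun k _ => (hC k).const_mul _

lemma Yit_diff {Q : ℝ → ℂ} {a : ℝ} (ha : 0 ≤ a) (hQ : IntervalIntegrable Q volume 0 a) (α β : ℂ)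
    (n : ℕ) {t : ℝ} (ht : t ∈ Icc 0 a) : Differentiable ℂ (fun l => Yit Q α β n l t) := by
  obtain ⟨N, C, hC, hY⟩ := Yit_poly ha hQ α β n
  simp_rw [fun l => hY l t ht]
  fun_prop

lemma Yit_bound {Q : ℝ → ℂ} {a : ℝ} (ha : 0 ≤ a) (hQ : IntervalIntegrable Q volume 0 a) (α β : ℂ)
    {L : ℝ} (hL0 : 0 < L) (l : ℂ) (hL : ∫ s in (0:ℝ)..a, ‖Q s + l‖ ≤ L) (n : ℕ) :
    ∀ t ∈ Icc 0 a, ‖Yit Q α β n l t‖ ≤ (‖α‖ + ‖β‖*a) * (1/2)^n * Real.exp (2*L*t) ∧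
      ‖∫ s in (0:ℝ)..t, (Q s + l) * Yit Q α β n l s‖ ≤
        L * ((‖α‖ + ‖β‖*a) * (1/2)^n * Real.exp (2*L*t)) := by
  set K := ‖α‖ + ‖β‖*a with hK
  have hK0 : 0 ≤ K := by positivity
  have hQl : IntervalIntegrable (fun s => Q s + l) volume 0 a := hQ.add (by simp)
  have step : ∀ n, (∀ t ∈ Icc 0 a, ‖Yit Q α β n l t‖ ≤ K * (1/2)^n * Real.exp (2*L*t)) →
      ∀ t ∈ Icc 0 a, ‖∫ s in (0:ℝ)..t, (Q s + l) * Yit Q α β n l s‖ ≤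
        L * (K * (1/2)^n * Real.exp (2*L*t)) := by
    intro n hn t ht
    have hQt := II_mono hQl ht
    have h1 : ‖∫ s in (0:ℝ)..t, (Q s + l) * Yit Q α β n l s‖ ≤
        ∫ s in (0:ℝ)..t, ‖Q s + l‖ * (K * (1/2)^n * Real.exp (2*L*t)) := by
      refine intervalIntegral.norm_integral_le_of_norm_le ht.1 (Eventually.of_forall fun s hs => ?_)
        (hQt.norm.mul_const _)
      rw [norm_mul]
      refine mul_le_mul_of_nonneg_left ((hn s ⟨hs.1.le, hs.2.trans ht.2⟩).trans ?_) (norm_nonneg _)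
      refine mul_le_mul_of_nonneg_left (Real.exp_le_exp.2 ?_) (by positivity)
      nlinarith [hs.2]
    rw [intervalIntegral.integral_mul_const] at h1
    refine h1.trans (mul_le_mul_of_nonneg_right (le_trans ?_ hL) (by positivity))
    exact intervalIntegral.integral_mono_interval le_rfl ht.1 ht.2
      (Eventually.of_forall fun _ => norm_nonneg _) hQl.norm
  have main : ∀ n, ∀ t ∈ Icc 0 a, ‖Yit Q α β n l t‖ ≤ K * (1/2)^n * Real.exp (2*L*t) := by
    intro n
    induction n with
    | zero =>
      intro t ht
      simp only [Yit, pow_zero, mul_one]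
      have h1 : ‖α + β * t‖ ≤ K := by
        refine (norm_add_le _ _).trans ?_
        rw [norm_mul, Complex.norm_real, Real.norm_of_nonneg ht.1]
        have := mul_le_mul_of_nonneg_left ht.2 (norm_nonneg β)
        linarith
      have h2 : 1 ≤ Real.exp (2*L*t) := Real.one_le_exp (by have := ht.1; positivity)
      nlinarith
    | succ n ih =>
      intro t ht
      rw [Yit]
      have h1 : ‖∫ s in (0:ℝ)..t, ∫ r in (0:ℝ)..s, (Q r + l) * Yit Q α β n l r‖ ≤
          ∫ s in (0:ℝ)..t, (L * (K * (1/2)^n)) * Real.exp (2*L*s) := by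
        refine intervalIntegral.norm_integral_le_of_norm_le ht.1
          (Eventually.of_forall fun s hs => ?_)
          ((by fun_prop : Continuous fun s => (L * (K * (1/2)^n)) * Real.exp (2*L*s)
            ).intervalIntegrable _ _)
        have := step n ih s ⟨hs.1.le, hs.2.trans ht.2⟩
        linarith
      have h2 : ∫ s in (0:ℝ)..t, Real.exp (2*L*s) = (Real.exp (2*L*t) - 1)/(2*L) := by
        rw [intervalIntegral.integral_comp_mul_left (fun x => Real.exp x) (by positivity)]
        simp
        ring
      rw [intervalIntegral.integral_const_mul, h2] at h1
      refine h1.trans ?_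
      have h3 : L * (K * (1/2)^n) * ((Real.exp (2*L*t) - 1)/(2*L)) =
          K * (1/2)^n * (1/2) * (Real.exp (2*L*t) - 1) := by field_simp
      rw [h3, pow_succ]
      have : 0 ≤ K * ((1/2)^n * (1/2)) := by positivity
      nlinarith
  exact fun t ht => ⟨main n t ht, step n (main n) t ht⟩

lemma sol_exists {Q : ℝ → ℂ} {a : ℝ} (ha : 0 ≤ a) (hQ : IntervalIntegrable Q volume 0 a) (α β : ℂ) :
    ∃ y w : ℂ → ℝ → ℂ, (∀ l, IsPrim (y l) (w l) a ∧ IsPrim (w l) (fun t => (Q t + l) * y l t) a ∧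
      y l 0 = α ∧ w l 0 = β) ∧ ∀ t ∈ Icc 0 a, Differentiable ℂ (fun l => y l t) := by
  set y : ℂ → ℝ → ℂ := fun l t => ∑' n, Yit Q α β n l t with hy
  set w : ℂ → ℝ → ℂ := fun l t => β + ∫ s in (0:ℝ)..t, (Q s + l) * y l s with hw
  set K := ‖α‖ + ‖β‖*a with hK
  have hK0 : 0 ≤ K := by positivity
  -- uniform bound on balls
  have hbd : ∀ r : ℝ, 0 ≤ r → ∃ L : ℝ, 0 < L ∧ ∀ l : ℂ, ‖l‖ ≤ r →
      ∫ s in (0:ℝ)..a, ‖Q s + l‖ ≤ L := by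
    intro r hr
    have h0 : 0 ≤ ∫ s in (0:ℝ)..a, ‖Q s‖ := intervalIntegral.integral_nonneg ha
      fun _ _ => norm_nonneg _
    refine ⟨(∫ s in (0:ℝ)..a, ‖Q s‖) + r * a + 1, by positivity, fun l hl => ?_⟩
    have h1 : ∫ s in (0:ℝ)..a, ‖Q s + l‖ ≤ ∫ s in (0:ℝ)..a, (‖Q s‖ + r) := by
      refine intervalIntegral.integral_mono_on ha (hQ.add (by simp)).norm
        (hQ.norm.add (by simp)) fun s _ => ?_
      exact (norm_add_le _ _).trans (by linarith)
    rw [intervalIntegral.integral_add hQ.norm (by simp), intervalIntegral.integral_const,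
      smul_eq_mul] at h1
    linarith
  have hgs : Summable (fun n : ℕ => (1/2:ℝ)^n) :=
    summable_geometric_of_lt_one (by norm_num) (by norm_num)
  refine ⟨y, w, fun l => ?_, fun t ht => ?_⟩
  · obtain ⟨L, hL0, hL⟩ := hbd ‖l‖ (norm_nonneg _)
    have hB := Yit_bound ha hQ α β hL0 l (hL l le_rfl)
    set E := Real.exp (2*L*a) with hE
    have hexp : ∀ t ∈ Icc 0 a, Real.exp (2*L*t) ≤ E := fun t ht =>
      Real.exp_le_exp.2 (by nlinarith [ht.2])
    have hb1 : ∀ n, ∀ t ∈ Icc 0 a, ‖Yit Q α β n l t‖ ≤ (1/2)^n * (K * E) := fun n t ht => by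
      refine ((hB n t ht).1).trans ?_
      have := mul_le_mul_of_nonneg_left (hexp t ht) (by positivity : 0 ≤ K * (1/2)^n)
      linarith
    have hb2 : ∀ n, ∀ t ∈ Icc 0 a, ‖∫ s in (0:ℝ)..t, (Q s + l) * Yit Q α β n l s‖ ≤
        (1/2)^n * (L * K * E) := fun n t ht => by
      refine ((hB n t ht).2).trans ?_
      have := mul_le_mul_of_nonneg_left (hexp t ht) (by positivity : 0 ≤ L * K * (1/2)^n)
      linarith
    have hs1 : Summable (fun n : ℕ => (1/2:ℝ)^n * (K*E)) := hgs.mul_right _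
    have hs2 : Summable (fun n : ℕ => (1/2:ℝ)^n * (L*K*E)) := hgs.mul_right _
    have hQl : IntervalIntegrable (fun s => Q s + l) volume 0 a := hQ.add (by simp)
    have hyc : ContinuousOn (y l) (Icc 0 a) :=
      continuousOn_tsum (fun n => Yit_cont ha hQ α β n l) hs1 hb1
    have hDc : ∀ n, ContinuousOn (fun t => ∫ s in (0:ℝ)..t, (Q s + l) * Yit Q α β n l s) (Icc 0 a) :=
      fun n => prim_cont ha (II_mul ha hQl (Yit_cont ha hQ α β n l))
    have hsumD : ∀ t ∈ Icc 0 a, ∑' n, ∫ s in (0:ℝ)..t, (Q s + l) * Yit Q α β n l s =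
        ∫ s in (0:ℝ)..t, (Q s + l) * y l s := by
      intro t ht
      have hsub : Icc 0 t ⊆ Icc 0 a := Icc_subset_Icc le_rfl ht.2
      exact (hasSum_mul_integral ht.1 (II_mono hQl ht)
        (fun n => (Yit_cont ha hQ α β n l).mono hsub) hs1
        (fun n s hs => hb1 n s (hsub hs))).tsum_eq
    have hyeq : ∀ t ∈ Icc 0 a, y l t = α + ∫ s in (0:ℝ)..t, w l s := by
      intro t ht
      have hsub : Icc 0 t ⊆ Icc 0 a := Icc_subset_Icc le_rfl ht.2
      have h1 := (hasSum_mul_integral (q := fun _ => 1) ht.1 (by simp)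
        (fun n => (hDc n).mono hsub) hs2 (fun n s hs => hb2 n s (hsub hs))).tsum_eq
      simp only [one_mul] at h1
      have h2 : Summable (fun n => Yit Q α β n l t) :=
        Summable.of_norm_bounded hs1 fun n => hb1 n t ht
      have h3 : y l t = (α + β * t) + ∑' n, Yit Q α β (n+1) l t := by
        simp only [hy]
        rw [h2.tsum_eq_zero_add]; rfl
      rw [h3]
      simp only [Yit]
      rw [h1]
      have h4 : ∫ s in (0:ℝ)..t, ∑' n, ∫ r in (0:ℝ)..s, (Q r + l) * Yit Q α β n l r =
          ∫ s in (0:ℝ)..t, ∫ r in (0:ℝ)..s, (Q r + l) * y l r := by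
        refine intervalIntegral.integral_congr fun s hs => ?_
        rw [uIcc_of_le ht.1] at hs
        exact hsumD s (hsub hs)
      rw [h4]
      simp only [hw]
      rw [intervalIntegral.integral_add (by simp)
        (II_mono (II_cont ha (prim_cont ha (II_mul ha hQl hyc))) ht)]
      simp
      ring
    have hwc : ContinuousOn (w l) (Icc 0 a) :=
      continuousOn_const.add (prim_cont ha (II_mul ha hQl hyc))
    have hy0 : y l 0 = α := by simpa using hyeq 0 ⟨le_rfl, ha⟩
    have hw0 : w l 0 = β := by simp [hw]
    refine ⟨⟨II_cont ha hwc, fun t ht => ?_⟩, ⟨II_mul ha hQl hyc, fun t ht => ?_⟩, hy0, hw0⟩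
    · rw [hy0]; exact hyeq t ht
    · rw [hw0]
  · intro l0
    obtain ⟨L, hL0, hL⟩ := hbd (‖l0‖+1) (by positivity)
    have : DifferentiableOn ℂ (fun l => y l t) (Metric.ball 0 (‖l0‖+1)) := by
      refine Complex.differentiableOn_tsum_of_summable_norm
        (u := fun n : ℕ => (1/2:ℝ)^n * (K * Real.exp (2*L*t))) (hgs.mul_right _)
        (fun n => (Yit_diff ha hQ α β n ht).differentiableOn) Metric.isOpen_ball fun n l hl => ?_
      have := (Yit_bound ha hQ α β hL0 l (hL l (by simpa using (mem_ball_zero_iff.1 hl).le)) n t ht).1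
      linarith
    exact this.differentiableAt (Metric.isOpen_ball.mem_nhds (by simp))

lemma norm_cosh_le (z : ℂ) {t : ℝ} (ht : 0 ≤ t) :
    ‖Complex.cosh (z*t)‖ ≤ Real.exp (|z.re| * t) := by
  rw [Complex.cosh, norm_div, Complex.norm_ofNat, div_le_iff₀ (by norm_num)]
  refine (norm_add_le _ _).trans ?_
  rw [Complex.norm_exp, Complex.norm_exp]
  have h1 : Real.exp (z*t).re ≤ Real.exp (|z.re| * t) := by
    apply Real.exp_le_exp.2
    simp only [Complex.mul_re, Complex.ofReal_re, Complex.ofReal_im, mul_zero, sub_zero]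
    exact mul_le_mul_of_nonneg_right (le_abs_self _) ht
  have h2 : Real.exp (-(z*t)).re ≤ Real.exp (|z.re| * t) := by
    apply Real.exp_le_exp.2
    simp only [Complex.neg_re, Complex.mul_re, Complex.ofReal_re, Complex.ofReal_im, mul_zero,
      sub_zero]
    rw [← neg_mul]
    exact mul_le_mul_of_nonneg_right (neg_le_abs _) ht
  linarith

lemma norm_sinh_le (z : ℂ) {t : ℝ} (ht : 0 ≤ t) :
    ‖Complex.sinh (z*t)‖ ≤ Real.exp (|z.re| * t) := by
  rw [Complex.sinh, norm_div, Complex.norm_ofNat, div_le_iff₀ (by norm_num)]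
  refine (norm_sub_le _ _).trans ?_
  rw [Complex.norm_exp, Complex.norm_exp]
  have h1 : Real.exp (z*t).re ≤ Real.exp (|z.re| * t) := by
    apply Real.exp_le_exp.2
    simp only [Complex.mul_re, Complex.ofReal_re, Complex.ofReal_im, mul_zero, sub_zero]
    exact mul_le_mul_of_nonneg_right (le_abs_self _) ht
  have h2 : Real.exp (-(z*t)).re ≤ Real.exp (|z.re| * t) := by
    apply Real.exp_le_exp.2
    simp only [Complex.neg_re, Complex.mul_re, Complex.ofReal_re, Complex.ofReal_im, mul_zero,
      sub_zero]
    rw [← neg_mul]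
    exact mul_le_mul_of_nonneg_right (neg_le_abs _) ht
  linarith

lemma voc {Q y w : ℝ → ℂ} {a : ℝ} {z : ℂ} (hz : z ≠ 0)
    (hy : IsPrim y w a) (hw : IsPrim w (fun t => (Q t + z^2) * y t) a) {t : ℝ} (ht : t ∈ Icc 0 a) :
    y t = Complex.cosh (z*t) * y 0 + Complex.sinh (z*t) / z * w 0 +
      ∫ s in (0:ℝ)..t, Complex.sinh (z*((t-s:ℝ):ℂ)) / z * (Q s * y s) := by
  have hy' := hy.mono ht
  have hw' := hw.mono ht
  have hlin : ∀ s : ℝ, HasDerivAt (fun s : ℝ => z*((t-s:ℝ):ℂ)) (-z) s := fun s => by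
    have := (((hasDerivAt_id s).const_sub t).ofReal_comp).const_mul z
    simpa using this
  have pc : IsPrim (fun s => Complex.cosh (z*((t-s:ℝ):ℂ)))
      (fun s => Complex.sinh (z*((t-s:ℝ):ℂ)) * (-z)) t :=
    IsPrim.of_hasDerivAt (fun s => HasDerivAt.comp s (Complex.hasDerivAt_cosh _) (hlin s)) (by fun_prop)
  have ps : IsPrim (fun s => Complex.sinh (z*((t-s:ℝ):ℂ)) / z)
      (fun s => (Complex.cosh (z*((t-s:ℝ):ℂ)) * (-z)) / z) t :=
    IsPrim.of_hasDerivAt (fun s => (HasDerivAt.comp s (Complex.hasDerivAt_sinh _) (hlin s)).div_const z) (by fun_prop)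
  have pF := ((pc.mul hy' ht.1).add (ps.mul hw' ht.1) ht.1).congr
    (q := fun s => Complex.sinh (z*((t-s:ℝ):ℂ)) / z * (Q s * y s)) (fun s _ => by
      field_simp; ring) ht.1
  have := pF.2 t ⟨ht.1, le_rfl⟩
  simpa using this

lemma sol_bound {Q y w : ℝ → ℂ} {a : ℝ} (ha : 0 ≤ a) (hQ : IntervalIntegrable Q volume 0 a)
    {z : ℂ} (hz : z ≠ 0) (hy : IsPrim y w a) (hw : IsPrim w (fun t => (Q t + z^2) * y t) a)
    (hzQ : 2 * ∫ s in (0:ℝ)..a, ‖Q s‖ ≤ ‖z‖) :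
    ∀ t ∈ Icc 0 a, ‖y t‖ ≤ 2 * (‖y 0‖ + ‖w 0‖ / ‖z‖) * Real.exp (|z.re| * t) := by
  set σ := |z.re| with hσ
  set A := ‖y 0‖ + ‖w 0‖ / ‖z‖ with hA
  set q := ∫ s in (0:ℝ)..a, ‖Q s‖ with hq
  have hz0 : 0 < ‖z‖ := norm_pos_iff.2 hz
  have hyc := hy.cont ha
  have hgc : ContinuousOn (fun s => ‖y s‖ * Real.exp (-(σ*s))) (Icc 0 a) := by fun_prop
  obtain ⟨s0, hs0, hmax⟩ := isCompact_Icc.exists_isMaxOn ⟨0, left_mem_Icc.2 ha⟩ hgc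
  set G := ‖y s0‖ * Real.exp (-(σ*s0)) with hG
  have hG0 : 0 ≤ G := by positivity
  have hyG : ∀ s ∈ Icc 0 a, ‖y s‖ ≤ G * Real.exp (σ*s) := by
    intro s hs
    have h1 : ‖y s‖ * Real.exp (-(σ*s)) ≤ G := hmax hs
    have h2 : Real.exp (-(σ*s)) * Real.exp (σ*s) = 1 := by rw [← Real.exp_add]; simp
    calc ‖y s‖ = ‖y s‖ * Real.exp (-(σ*s)) * Real.exp (σ*s) := by rw [mul_assoc, h2, mul_one]
      _ ≤ _ := by gcongr
  have hInt0 : ‖∫ s in (0:ℝ)..s0, Complex.sinh (z*((s0-s:ℝ):ℂ)) / z * (Q s * y s)‖ ≤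
      Real.exp (σ*s0) * (G / 2) := by
    have h1 : ‖∫ s in (0:ℝ)..s0, Complex.sinh (z*((s0-s:ℝ):ℂ)) / z * (Q s * y s)‖ ≤
        ∫ s in (0:ℝ)..s0, ‖Q s‖ * (Real.exp (σ*s0) * G / ‖z‖) := by
      refine intervalIntegral.norm_integral_le_of_norm_le hs0.1
        (Eventually.of_forall fun s hs => ?_) ((II_mono hQ hs0).norm.mul_const _)
      rw [norm_mul, norm_mul, norm_div]
      have e1 := norm_sinh_le z (sub_nonneg.2 hs.2)
      have e2 := hyG s ⟨hs.1.le, hs.2.trans hs0.2⟩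
      have e3 : Real.exp (σ*(s0-s)) * Real.exp (σ*s) = Real.exp (σ*s0) := by
        rw [← Real.exp_add]; congr 1; ring
      calc ‖Complex.sinh (z*((s0-s:ℝ):ℂ))‖ / ‖z‖ * (‖Q s‖ * ‖y s‖)
          ≤ Real.exp (σ*(s0-s)) / ‖z‖ * (‖Q s‖ * (G * Real.exp (σ*s))) := by gcongr
        _ = ‖Q s‖ * ((Real.exp (σ*(s0-s)) * Real.exp (σ*s)) * G / ‖z‖) := by ring
        _ = _ := by rw [e3]
    rw [intervalIntegral.integral_mul_const] at h1
    have h2 : ∫ s in (0:ℝ)..s0, ‖Q s‖ ≤ ‖z‖ / 2 := by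
      have : ∫ s in (0:ℝ)..s0, ‖Q s‖ ≤ q :=
        intervalIntegral.integral_mono_interval le_rfl hs0.1 hs0.2
          (Eventually.of_forall fun _ => norm_nonneg _) hQ.norm
      linarith
    calc _ ≤ _ := h1
      _ ≤ ‖z‖ / 2 * (Real.exp (σ*s0) * G / ‖z‖) := by gcongr
      _ = _ := by field_simp
  have hv := voc hz hy hw hs0
  have hb : ‖y s0‖ ≤ Real.exp (σ*s0) * (A + G/2) := by
    rw [hv]
    refine (norm_add₃_le).trans ?_
    rw [norm_mul, norm_mul, norm_div]
    have e1 := norm_cosh_le z hs0.1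
    have e2 := norm_sinh_le z hs0.1
    have e3 : ‖Complex.cosh (z*s0)‖ * ‖y 0‖ ≤ Real.exp (σ*s0) * ‖y 0‖ := by gcongr
    have e4 : ‖Complex.sinh (z*s0)‖ / ‖z‖ * ‖w 0‖ ≤ Real.exp (σ*s0) / ‖z‖ * ‖w 0‖ := by gcongr
    have e5 : Real.exp (σ*s0) * (A + G/2) = Real.exp (σ*s0) * ‖y 0‖ +
      Real.exp (σ*s0) / ‖z‖ * ‖w 0‖ + Real.exp (σ*s0) * (G/2) := by rw [hA]; ring
    rw [e5]
    linarith
  have hGA : G ≤ 2 * A := by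
    have h2 : Real.exp (-(σ*s0)) * Real.exp (σ*s0) = 1 := by rw [← Real.exp_add]; simp
    have : G ≤ A + G/2 := by
      calc G ≤ (Real.exp (σ*s0) * (A + G/2)) * Real.exp (-(σ*s0)) := by
            rw [hG]; gcongr
        _ = (Real.exp (-(σ*s0)) * Real.exp (σ*s0)) * (A + G/2) := by ring
        _ = _ := by rw [h2, one_mul]
    linarith
  intro t ht
  refine (hyG t ht).trans ?_
  gcongr

lemma theta_re_pos {Q y w : ℝ → ℂ} {a : ℝ} (ha : 0 ≤ a) (hQ : IntervalIntegrable Q volume 0 a)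
    {z : ℝ} (hz : 0 < z) (hy : IsPrim y w a) (hw : IsPrim w (fun t => (Q t + (z:ℂ)^2) * y t) a)
    (hy0 : y 0 = 1) (hw0 : w 0 = 0)
    (hzQ : 8 * ∫ s in (0:ℝ)..a, ‖Q s‖ < z) : ∀ t ∈ Icc 0 a, 0 < (y t).re := by
  intro t ht
  have hq0 : 0 ≤ ∫ s in (0:ℝ)..a, ‖Q s‖ := intervalIntegral.integral_nonneg ha
      fun _ _ => norm_nonneg _
  set q := ∫ s in (0:ℝ)..a, ‖Q s‖ with hq
  have hzc : (z:ℂ) ≠ 0 := by exact_mod_cast hz.ne'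
  have hzn : ‖(z:ℂ)‖ = z := by rw [Complex.norm_real, Real.norm_of_nonneg hz.le]
  have hzr : |(z:ℂ).re| = z := by simp [abs_of_pos hz]
  have hb := sol_bound ha hQ hzc hy hw (by rw [hzn]; linarith)
  rw [hy0, hw0, hzr] at hb
  simp only [norm_one, norm_zero, zero_div, add_zero, mul_one] at hb
  have hv := voc hzc hy hw ht
  rw [hy0, hw0] at hv
  simp only [mul_one, mul_zero, add_zero] at hv
  have h1 : ‖∫ s in (0:ℝ)..t, Complex.sinh (z*((t-s:ℝ):ℂ)) / z * (Q s * y s)‖ ≤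
      ∫ s in (0:ℝ)..t, ‖Q s‖ * (Real.exp (z*t) * 2 / z) := by
    refine intervalIntegral.norm_integral_le_of_norm_le ht.1
      (Eventually.of_forall fun s hs => ?_) ((II_mono hQ ht).norm.mul_const _)
    rw [norm_mul, norm_mul, norm_div, hzn]
    have e1 := norm_sinh_le z (sub_nonneg.2 hs.2)
    rw [hzr] at e1
    have e2 := hb s ⟨hs.1.le, hs.2.trans ht.2⟩
    have e3 : Real.exp (z*(t-s)) * Real.exp (z*s) = Real.exp (z*t) := by
      rw [← Real.exp_add]; congr 1; ring
    calc ‖Complex.sinh (z*((t-s:ℝ):ℂ))‖ / z * (‖Q s‖ * ‖y s‖)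
        ≤ Real.exp (z*(t-s)) / z * (‖Q s‖ * (2 * Real.exp (z*s))) := by gcongr
      _ = ‖Q s‖ * ((Real.exp (z*(t-s)) * Real.exp (z*s)) * 2 / z) := by ring
      _ = _ := by rw [e3]
  rw [intervalIntegral.integral_mul_const] at h1
  have h2 : ∫ s in (0:ℝ)..t, ‖Q s‖ ≤ q :=
      intervalIntegral.integral_mono_interval le_rfl ht.1 ht.2
        (Eventually.of_forall fun _ => norm_nonneg _) hQ.norm
  set J := ∫ s in (0:ℝ)..t, Complex.sinh (z*((t-s:ℝ):ℂ)) / z * (Q s * y s) with hJ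
  have h3 : ‖J‖ ≤ Real.exp (z*t) / 4 := by
    calc ‖J‖ ≤ _ := h1
      _ ≤ (z/8) * (Real.exp (z*t) * 2 / z) := by gcongr; linarith
      _ = _ := by field_simp; norm_num
  have h4 : (y t).re = Real.cosh (z*t) + J.re := by
    rw [hv, Complex.add_re, ← Complex.ofReal_mul, ← Complex.ofReal_cosh, Complex.ofReal_re]
  have h5 : -‖J‖ ≤ J.re := (abs_le.1 (Complex.abs_re_le_norm J)).1
  have h6 : Real.exp (z*t) / 2 ≤ Real.cosh (z*t) := by
    rw [Real.cosh_eq]; have := Real.exp_pos (-(z*t)); linarith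
  have := Real.exp_pos (z*t)
  rw [h4]; linarith

lemma entire_zero {g : ℂ → ℂ} (hd : Differentiable ℂ g) (hev : ∀ z, g (-z) = g z) {M x : ℝ}
    (hb : ∀ z, ‖g z‖ ≤ M * Real.exp (x * |z.re|)) (hx : 0 ≤ x)
    (hre : Tendsto (fun r : ℝ => g r) atTop (𝓝 0)) : ∀ z, g z = 0 := by
  have hM : 0 ≤ M := by
    have := (norm_nonneg _).trans (hb 0)
    simpa using this
  have hR : ∀ z : ℂ, 0 ≤ z.re → ‖g z‖ ≤ M := by
    intro z hz
    refine PhragmenLindelof.right_half_plane_of_tendsto_zero_on_real hd.diffContOnCl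
      ⟨1, by norm_num, x, ?_⟩ hre (fun r => ?_) hz
    · refine Asymptotics.IsBigO.of_bound M (Eventually.of_forall fun z => ?_)
      refine (hb z).trans ?_
      rw [Real.norm_eq_abs, Real.abs_exp, Real.rpow_one]
      refine mul_le_mul_of_nonneg_left (Real.exp_le_exp.2 ?_) hM
      exact mul_le_mul_of_nonneg_left (Complex.abs_re_le_norm z) hx
    · have := hb (r * Complex.I)
      simpa using this
  have hall : ∀ z, ‖g z‖ ≤ M := by
    intro z
    rcases le_total 0 z.re with h | h
    · exact hR z h
    · rw [← hev]; exact hR (-z) (by simpa using h)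
  have hbd : Bornology.IsBounded (range g) := by
    rw [isBounded_iff_forall_norm_le]
    exact ⟨M, by rintro _ ⟨z, rfl⟩; exact hall z⟩
  intro z
  have hc : ∀ r : ℝ, g r = g z := fun r => hd.apply_eq_apply_of_bounded hbd _ _
  simp_rw [hc] at hre
  exact tendsto_nhds_unique tendsto_const_nhds hre

lemma pot_eq_of_theta {Q₁ Q₂ t1 dt1 t2 dt2 p1 dp1 p2 dp2 : ℝ → ℂ} {l : ℂ} {a : ℝ} (ha : 0 < a)
    (ht1 : IsPrim t1 dt1 a) (hdt1 : IsPrim dt1 (fun t => (Q₁ t + l) * t1 t) a)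
    (ht2 : IsPrim t2 dt2 a) (hdt2 : IsPrim dt2 (fun t => (Q₂ t + l) * t2 t) a)
    (hp1 : IsPrim p1 dp1 a) (hdp1 : IsPrim dp1 (fun t => (Q₁ t + l) * p1 t) a)
    (hp2 : IsPrim p2 dp2 a) (hdp2 : IsPrim dp2 (fun t => (Q₂ t + l) * p2 t) a)
    (it1 : t1 0 = 1) (idt1 : dt1 0 = 0) (it2 : t2 0 = 1) (idt2 : dt2 0 = 0)
    (ip1 : p1 0 = 0) (idp1 : dp1 0 = 1) (ip2 : p2 0 = 0) (idp2 : dp2 0 = 1)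
    (hpos1 : ∀ t ∈ Icc 0 a, 0 < (t1 t).re) (hpos2 : ∀ t ∈ Icc 0 a, 0 < (t2 t).re)
    (hid : ∀ t ∈ Icc 0 a, p1 t * t2 t = p2 t * t1 t) :
    ∀ᵐ t, t ∈ Ioo 0 a → Q₁ t = Q₂ t := by
  have wr : ∀ (Q t dt p dp : ℝ → ℂ), IsPrim t dt a → IsPrim dt (fun s => (Q s + l) * t s) a →
      IsPrim p dp a → IsPrim dp (fun s => (Q s + l) * p s) a → t 0 = 1 → dt 0 = 0 → p 0 = 0 →
      dp 0 = 1 → ∀ x ∈ Icc 0 a, dp x * t x - p x * dt x = 1 := by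
    intro Q t dt p dp h1 h2 h3 h4 i1 i2 i3 i4 x hx
    have := (((h4.mul h1 ha.le).sub (h3.mul h2 ha.le) ha.le).congr (q := fun _ => 0)
      (fun s _ => by ring) ha.le).2 x hx
    simpa [i1, i2, i3, i4] using this
  have w1 := wr Q₁ t1 dt1 p1 dp1 ht1 hdt1 hp1 hdp1 it1 idt1 ip1 idp1
  have w2 := wr Q₂ t2 dt2 p2 dp2 ht2 hdt2 hp2 hdp2 it2 idt2 ip2 idp2
  have hsub : Ioo 0 a ⊆ Icc 0 a := Ioo_subset_Icc_self
  have heq : ∀ t ∈ Ioo 0 a, t1 t = t2 t := by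
    intro t ht
    have d1 := ht1.hasDerivAt (hdt1.cont ha.le) ht
    have d2 := ht2.hasDerivAt (hdt2.cont ha.le) ht
    have d3 := hp1.hasDerivAt (hdp1.cont ha.le) ht
    have d4 := hp2.hasDerivAt (hdp2.cont ha.le) ht
    have e1 := d3.mul d2
    have e2 := d4.mul d1
    have e3 : (fun s => p2 s * t1 s) =ᶠ[𝓝 t] (fun s => p1 s * t2 s) := by
      filter_upwards [isOpen_Ioo.mem_nhds ht] with s hs
      exact (hid s (hsub hs)).symm
    have e4 := e1.unique (e2.congr_of_eventuallyEq e3.symm)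
    have hi := hid t (hsub ht)
    have h1 := w1 t (hsub ht)
    have h2 := w2 t (hsub ht)
    have hsq : t1 t * t1 t = t2 t * t2 t := by
      linear_combination (t1 t * t2 t) * (-e4) + (t2 t)^2 * h1 - (t1 t)^2 * h2 +
        (dt1 t * t2 t + dt2 t * t1 t) * hi
    rcases mul_self_eq_mul_self_iff.1 hsq with h | h
    · exact h
    · exfalso
      have := congrArg Complex.re h
      rw [Complex.neg_re] at this
      linarith [hpos1 t (hsub ht), hpos2 t (hsub ht)]
  have hdeq : ∀ t ∈ Ioo 0 a, dt1 t = dt2 t := by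
    intro t ht
    have d1 := ht1.hasDerivAt (hdt1.cont ha.le) ht
    have d2 := ht2.hasDerivAt (hdt2.cont ha.le) ht
    have e3 : t1 =ᶠ[𝓝 t] t2 := by
      filter_upwards [isOpen_Ioo.mem_nhds ht] with s hs
      exact heq s hs
    exact d1.unique (d2.congr_of_eventuallyEq e3)
  have hz := ae_zero_of_integral_zero (b := a)
    (f := fun t => (Q₁ t + l) * t1 t - (Q₂ t + l) * t2 t) (hdt1.1.sub hdt2.1) (fun τ hτ => by
      have e1 := hdt1.2 τ (hsub hτ)
      have e2 := hdt2.2 τ (hsub hτ)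
      rw [intervalIntegral.integral_sub (hdt1.mono (hsub hτ)).1 (hdt2.mono (hsub hτ)).1]
      rw [idt1, zero_add] at e1
      rw [idt2, zero_add] at e2
      rw [← e1, ← e2, hdeq τ hτ, sub_self])
  filter_upwards [hz] with t ht htm
  have h1 := ht htm
  rw [← heq t htm] at h1
  have h2 : t1 t ≠ 0 := fun h => by
    have := hpos1 t (hsub htm)
    rw [h] at this; simp at this
  have h3 : (Q₁ t - Q₂ t) * t1 t = 0 := by linear_combination h1
  rcases mul_eq_zero.1 h3 with h | h
  · exact sub_eq_zero.1 h
  · exact absurd h h2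

/-- Expansion of a solution in the fundamental system. -/
lemma weyl_expand {Q t dt p dp v w : ℝ → ℂ} {a : ℝ} (ha : 0 ≤ a)
    (hQ : IntervalIntegrable Q volume 0 a) {z : ℂ} (hz : z ≠ 0)
    (hzQ : 2 * ∫ s in (0:ℝ)..a, ‖Q s‖ ≤ ‖z‖)
    (ht : IsPrim t dt a) (hdt : IsPrim dt (fun s => (Q s + z^2) * t s) a)
    (hp : IsPrim p dp a) (hdp : IsPrim dp (fun s => (Q s + z^2) * p s) a)
    (hv : IsPrim v w a) (hw : IsPrim w (fun s => (Q s + z^2) * v s) a)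
    (it : t 0 = 1) (idt : dt 0 = 0) (ip : p 0 = 0) (idp : dp 0 = 1) (iv : v 0 = 1) :
    ∀ x ∈ Icc 0 a, v x = t x + w 0 * p x := by
  intro x hx
  have h1 := (hv.sub (ht.add (hp.const_mul (w 0)) ha) ha)
  have h2 := (hw.sub (hdt.add (hdp.const_mul (w 0)) ha) ha).congr
    (q := fun s => (Q s + z^2) * (v s - (t s + w 0 * p s))) (fun s _ => by ring) ha
  have h3 := sol_bound ha hQ hz h1 h2 hzQ x hx
  simp only [it, idt, ip, idp, iv] at h3
  simp only [mul_zero, add_zero, sub_self, mul_one, zero_add, norm_zero, zero_div, zero_mul] at h3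
  exact sub_eq_zero.1 (norm_le_zero_iff.1 h3)

/-- Equal amplitudes on `(0,a)` give equal potentials there. -/
lemma pot_of_amp {κ a s : ℝ} (ha : 0 < a) {Q₁ Q₂ A₁ A₂ : ℝ → ℝ} (hQA1 : MemA1 Q₁)
    (hQA2 : MemA1 Q₂) (hA1 : IsAmplitude κ Q₁ s A₁) (hA2 : IsAmplitude κ Q₂ s A₂)
    (h : ∀ᵐ t, t ∈ Ioo 0 a → A₁ t = A₂ t) : ∀ᵐ t, t ∈ Ioo 0 a → Q₁ t = Q₂ t := by
  obtain ⟨C, hC⟩ := m_close ha hA1 hA2 h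
  obtain ⟨R1, y1, hR1, H1⟩ := weyl_exists hQA1
  obtain ⟨R2, y2, hR2, H2⟩ := weyl_exists hQA2
  have hi1 : IntervalIntegrable (fun t => (Q₁ t : ℂ)) volume 0 a := by
    have h := hQA1.intervalIntegrable ha.le
    exact ⟨h.1.ofReal, h.2.ofReal⟩
  have hi2 : IntervalIntegrable (fun t => (Q₂ t : ℂ)) volume 0 a := by
    have h := hQA2.intervalIntegrable ha.le
    exact ⟨h.1.ofReal, h.2.ofReal⟩
  obtain ⟨t1, dt1, ht1, et1⟩ := sol_exists ha.le hi1 1 0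
  obtain ⟨t2, dt2, ht2, et2⟩ := sol_exists ha.le hi2 1 0
  obtain ⟨p1, dp1, hp1, ep1⟩ := sol_exists ha.le hi1 0 1
  obtain ⟨p2, dp2, hp2, ep2⟩ := sol_exists ha.le hi2 0 1
  have hq1 : 0 ≤ ∫ s in (0:ℝ)..a, ‖(Q₁ s : ℂ)‖ := intervalIntegral.integral_nonneg ha.le
      fun _ _ => norm_nonneg _
  have hq2 : 0 ≤ ∫ s in (0:ℝ)..a, ‖(Q₂ s : ℂ)‖ := intervalIntegral.integral_nonneg ha.le
      fun _ _ => norm_nonneg _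
  set q1 := ∫ s in (0:ℝ)..a, ‖(Q₁ s : ℂ)‖ with hq1d
  set q2 := ∫ s in (0:ℝ)..a, ‖(Q₂ s : ℂ)‖ with hq2d
  set Z := 2*q1 + 2*q2 + 1 with hZ
  -- bounds for large z
  have bt1 : ∀ z : ℂ, Z ≤ ‖z‖ → ∀ x ∈ Icc 0 a, ‖t1 (z^2) x‖ ≤ 2 * Real.exp (|z.re| * x) := by
    intro z hz x hx
    have hz0 : z ≠ 0 := norm_pos_iff.1 (by linarith)
    have := sol_bound ha.le hi1 hz0 (ht1 (z^2)).1 (ht1 (z^2)).2.1 (by linarith) x hx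
    rw [(ht1 (z^2)).2.2.1, (ht1 (z^2)).2.2.2] at this
    simpa using this
  have bt2 : ∀ z : ℂ, Z ≤ ‖z‖ → ∀ x ∈ Icc 0 a, ‖t2 (z^2) x‖ ≤ 2 * Real.exp (|z.re| * x) := by
    intro z hz x hx
    have hz0 : z ≠ 0 := norm_pos_iff.1 (by linarith)
    have := sol_bound ha.le hi2 hz0 (ht2 (z^2)).1 (ht2 (z^2)).2.1 (by linarith) x hx
    rw [(ht2 (z^2)).2.2.1, (ht2 (z^2)).2.2.2] at this
    simpa using this
  have bp1 : ∀ z : ℂ, Z ≤ ‖z‖ → ∀ x ∈ Icc 0 a,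
      ‖p1 (z^2) x‖ ≤ 2 * (1/‖z‖) * Real.exp (|z.re| * x) := by
    intro z hz x hx
    have hz0 : z ≠ 0 := norm_pos_iff.1 (by linarith)
    have := sol_bound ha.le hi1 hz0 (hp1 (z^2)).1 (hp1 (z^2)).2.1 (by linarith) x hx
    rw [(hp1 (z^2)).2.2.1, (hp1 (z^2)).2.2.2] at this
    simpa using this
  have bp2 : ∀ z : ℂ, Z ≤ ‖z‖ → ∀ x ∈ Icc 0 a,
      ‖p2 (z^2) x‖ ≤ 2 * (1/‖z‖) * Real.exp (|z.re| * x) := by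
    intro z hz x hx
    have hz0 : z ≠ 0 := norm_pos_iff.1 (by linarith)
    have := sol_bound ha.le hi2 hz0 (hp2 (z^2)).1 (hp2 (z^2)).2.1 (by linarith) x hx
    rw [(hp2 (z^2)).2.2.1, (hp2 (z^2)).2.2.2] at this
    simpa using this
  have key : ∀ x ∈ Icc 0 a, ∀ z : ℂ, p1 (z^2) x * t2 (z^2) x - p2 (z^2) x * t1 (z^2) x = 0 := by
    intro x hx
    have hsq : Differentiable ℂ (fun z : ℂ => z^2) := by fun_prop
    have hd : Differentiable ℂ
        (fun z : ℂ => p1 (z^2) x * t2 (z^2) x - p2 (z^2) x * t1 (z^2) x) :=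
      (((ep1 x hx).comp hsq).mul ((et2 x hx).comp hsq)).sub
        (((ep2 x hx).comp hsq).mul ((et1 x hx).comp hsq))
    obtain ⟨M, hM⟩ := (isCompact_closedBall (0:ℂ) Z).exists_bound_of_continuousOn
      hd.continuous.continuousOn
    have hM0 : 0 ≤ M := (norm_nonneg _).trans (hM 0 (by simp; linarith))
    refine entire_zero (M := M + 8) (x := 2*x) hd (fun z => by simp) (fun z => ?_)
      (by linarith [hx.1]) ?_
    · have hE : 1 ≤ Real.exp (2*x * |z.re|) := Real.one_le_exp
        (mul_nonneg (by linarith [hx.1]) (abs_nonneg _))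
      rcases le_total ‖z‖ Z with hz | hz
      · have := hM z (by simpa using hz)
        nlinarith
      · have hn : 1/‖z‖ ≤ 1 := by
          rw [div_le_one (by linarith)]; linarith
        have e0 := Real.exp_pos (|z.re| * x)
        have c1 : ‖p1 (z^2) x‖ ≤ 2 * Real.exp (|z.re| * x) :=
          (bp1 z hz x hx).trans (by gcongr; linarith)
        have c2 : ‖p2 (z^2) x‖ ≤ 2 * Real.exp (|z.re| * x) :=
          (bp2 z hz x hx).trans (by gcongr; linarith)
        have e2 : Real.exp (2*x * |z.re|) = Real.exp (|z.re| * x) * Real.exp (|z.re| * x) := by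
          rw [← Real.exp_add]; ring_nf
        have d1 := mul_le_mul c1 (bt2 z hz x hx) (norm_nonneg _) (by positivity)
        have d2 := mul_le_mul c2 (bt1 z hz x hx) (norm_nonneg _) (by positivity)
        refine (norm_sub_le _ _).trans ?_
        rw [norm_mul, norm_mul]
        nlinarith
    · refine squeeze_zero_norm' (a := fun z : ℝ =>
        (2 * Real.exp (R2*x) + 2 * Real.exp (R1*x) + 4 * |C|) / z) ?_
        (tendsto_const_nhds.div_atTop tendsto_id)
      filter_upwards [eventually_ge_atTop Z, eventually_ge_atTop y1, eventually_ge_atTop y2,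
        eventually_ge_atTop 1, eventually_ge_atTop (2*|κ|), eventually_ge_atTop s]
        with z hzZ hzy1 hzy2 hz1 hzk hzs
      obtain ⟨v1, w1, S1, i1, P1, B1⟩ := H1 z hzy1
      obtain ⟨v2, w2, S2, i2, P2, B2⟩ := H2 z hzy2
      have hm := hC z hz1 hzk hzs v1 w1 v2 w2 S1 S2
      have hz0 : 0 < z := by linarith
      have hzc : (z:ℂ) ≠ 0 := by exact_mod_cast hz0.ne'
      have hzn : ‖(z:ℂ)‖ = z := by rw [Complex.norm_real, Real.norm_of_nonneg hz0.le]
      have hzr : |(z:ℂ).re| = z := by simp [abs_of_pos hz0]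
      have x1 := weyl_expand ha.le hi1 hzc (by linarith) (ht1 _).1 (ht1 _).2.1 (hp1 _).1
        (hp1 _).2.1 (P1 a ha.le).1 (P1 a ha.le).2 (ht1 _).2.2.1 (ht1 _).2.2.2 (hp1 _).2.2.1
        (hp1 _).2.2.2 i1 x hx
      have x2 := weyl_expand ha.le hi2 hzc (by linarith) (ht2 _).1 (ht2 _).2.1 (hp2 _).1
        (hp2 _).2.1 (P2 a ha.le).1 (P2 a ha.le).2 (ht2 _).2.2.1 (ht2 _).2.2.2 (hp2 _).2.2.1
        (hp2 _).2.2.2 i2 x hx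
      have b1 := bp1 z (by rw [hzn]; exact hzZ) x hx
      have b2 := bp2 z (by rw [hzn]; exact hzZ) x hx
      rw [hzn, hzr] at b1 b2
      have c1 := (B1 x hx.1).1
      have c2 := (B2 x hx.1).1
      have eq : p1 ((z:ℂ)^2) x * t2 ((z:ℂ)^2) x - p2 ((z:ℂ)^2) x * t1 ((z:ℂ)^2) x =
          p1 ((z:ℂ)^2) x * v2 x - p2 ((z:ℂ)^2) x * v1 x +
            (w1 0 - w2 0) * (p1 ((z:ℂ)^2) x * p2 ((z:ℂ)^2) x) := by
        rw [x1, x2]; ring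
      rw [eq]
      have f1 : ‖p1 ((z:ℂ)^2) x * v2 x‖ ≤ 2 * Real.exp (R2*x) / z := by
        rw [norm_mul]
        refine (mul_le_mul b1 c2 (norm_nonneg _) (by positivity)).trans (le_of_eq ?_)
        rw [mul_assoc, ← Real.exp_add, show z*x + -(z-R2)*x = R2*x by ring]; ring
      have f2 : ‖p2 ((z:ℂ)^2) x * v1 x‖ ≤ 2 * Real.exp (R1*x) / z := by
        rw [norm_mul]
        refine (mul_le_mul b2 c1 (norm_nonneg _) (by positivity)).trans (le_of_eq ?_)
        rw [mul_assoc, ← Real.exp_add, show z*x + -(z-R1)*x = R1*x by ring]; ring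
      have f3 : ‖(w1 0 - w2 0) * (p1 ((z:ℂ)^2) x * p2 ((z:ℂ)^2) x)‖ ≤ 4 * |C| / z := by
        rw [norm_mul, norm_mul]
        have g1 : ‖w1 0 - w2 0‖ ≤ |C| * Real.exp (-2*a*z) :=
          hm.trans (mul_le_mul_of_nonneg_right (le_abs_self _) (Real.exp_pos _).le)
        refine (mul_le_mul g1 (mul_le_mul b1 b2 (norm_nonneg _) (by positivity)) (by positivity)
          (by positivity)).trans ?_
        have g2 : Real.exp (-2*a*z) * (Real.exp (z*x) * Real.exp (z*x)) ≤ 1 := by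
          rw [← Real.exp_add, ← Real.exp_add, Real.exp_le_one_iff]
          nlinarith [hx.2]
        have g3 : 1/z ≤ 1 := by rw [div_le_one hz0]; exact hz1
        have g4 : 0 ≤ 1/z := by positivity
        calc |C| * Real.exp (-2*a*z) * (2*(1/z) * Real.exp (z*x) * (2*(1/z) * Real.exp (z*x)))
            = (4 * |C| * (1/z)) * ((1/z) * (Real.exp (-2*a*z) *
              (Real.exp (z*x) * Real.exp (z*x)))) := by ring
          _ ≤ (4 * |C| * (1/z)) * (1 * 1) := by gcongr
          _ = 4 * |C| / z := by ring
      refine (norm_add_le _ _).trans ?_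
      have f4 := norm_sub_le (p1 ((z:ℂ)^2) x * v2 x) (p2 ((z:ℂ)^2) x * v1 x)
      rw [add_div, add_div]
      linarith
  set z : ℝ := 8*q1 + 8*q2 + 1 with hz
  have hz0 : 0 < z := by linarith
  have hpos1 := theta_re_pos ha.le hi1 hz0 (ht1 _).1 (ht1 _).2.1 (ht1 _).2.2.1 (ht1 _).2.2.2
    (by linarith)
  have hpos2 := theta_re_pos ha.le hi2 hz0 (ht2 _).1 (ht2 _).2.1 (ht2 _).2.2.1 (ht2 _).2.2.2
    (by linarith)
  have fin := pot_eq_of_theta (l := (z:ℂ)^2) ha (ht1 _).1 (ht1 _).2.1 (ht2 _).1 (ht2 _).2.1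
    (hp1 _).1 (hp1 _).2.1 (hp2 _).1 (hp2 _).2.1 (ht1 _).2.2.1 (ht1 _).2.2.2 (ht2 _).2.2.1
    (ht2 _).2.2.2 (hp1 _).2.2.1 (hp1 _).2.2.2 (hp2 _).2.2.1 (hp2 _).2.2.2 hpos1 hpos2
    (fun t ht => sub_eq_zero.1 (key t ht z))
  filter_upwards [fin] with t ht htm
  exact Complex.ofReal_injective (ht htm)

end Helpers

/-- local uniqueness — the `A_κ`-amplitudes agree a.e. on `(0,a)` iff the
potentials agree a.e. on `(0,a)`. -/
theorem amplitude_local_uniqueness (κ : ℝ) (a : ℝ) (ha : 0 < a)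
    (Q₁ Q₂ : ℝ → ℝ) (hQA1 : MemA1 Q₁) (hQA2 : MemA1 Q₂)
    (s : ℝ) (hs1 : AdmissibleThreshold κ Q₁ s) (hs2 : AdmissibleThreshold κ Q₂ s)
    (A₁ A₂ : ℝ → ℝ) (hA1 : IsAmplitude κ Q₁ s A₁) (hA2 : IsAmplitude κ Q₂ s A₂) :
    (A₁ =ᵐ[MeasureTheory.volume.restrict (Set.Ioo (0 : ℝ) a)] A₂) ↔
      (Q₁ =ᵐ[MeasureTheory.volume.restrict (Set.Ioo (0 : ℝ) a)] Q₂) := by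
  have e : ∀ f g : ℝ → ℝ, (f =ᵐ[volume.restrict (Set.Ioo (0 : ℝ) a)] g) ↔
      ∀ᵐ t, t ∈ Set.Ioo (0 : ℝ) a → f t = g t := fun f g => by
    rw [Filter.EventuallyEq, ae_restrict_iff' measurableSet_Ioo]
  rw [e, e]
  exact ⟨pot_of_amp ha hQA1 hQA2 hA1 hA2, amp_of_pot ha hQA1 hQA2 hA1 hA2⟩
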